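/- arXiv:1307.5157 — 5 statements merged into one kernel-verified Lean document; each statement's English description precedes it below -/
import Mathlib

section
/- For every integer d ≥ 1 and every n ≥ d + 1, there exists a sequence P = (p_1, …, p_M) of M = twr_d(n − d) points in ℝ^d, in strong general position (for each j = 1, …, d, any j + 1 of the projected points π_j(p_i) are affinely independent), that contains no super-order-type homogeneous subsequence of length n. Consequently the Ramsey function OT*_d satisfies OT*_d(n) ≥ twr_d(n − d). -/
open scoped Classical

noncomputable section

/-- Tower function: `twr 1 x = x`, `twr (i+1) x = 2 ^ twr i x`. -/
def twr : ℕ → ℕ → ℕ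
  | 0, x => x
  | 1, x => x
  | (n+2), x => 2 ^ twr (n+1) x

/-- Real tower function: `rtwr 1 x = x`, `rtwr (i+1) x = 2 ^ rtwr i x`. -/
def rtwr : ℕ → ℝ → ℝ
  | 0, x => x
  | 1, x => x
  | (n+2), x => (2 : ℝ) ^ rtwr (n+1) x

/-- The `t`-th coordinate (0-based) of a point of `ℝ^d`, extended by 0 out of range. -/
def coordE {d : ℕ} (x : Fin d → ℝ) (t : ℕ) : ℝ := if h : t < d then x ⟨t, h⟩ else 0

/-- `Dj j T` is the determinant `D_j(T)` of the `m × m` matrix whose `i`-th column consists of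
`1`, the (1-based) coordinates `1, …, m-2` of `T i`, and finally the (1-based) `j`-th
coordinate of `T i`.  (For `m = 1` it is just the `j`-th coordinate of the point.) -/
def Dj {d m : ℕ} (j : ℕ) (T : Fin m → (Fin d → ℝ)) : ℝ :=
  Matrix.det (Matrix.of (fun (r i : Fin m) =>
    if (r : ℕ) = m - 1 then coordE (T i) (j - 1)
    else if (r : ℕ) = 0 then (1 : ℝ)
    else coordE (T i) ((r : ℕ) - 1)))

/-- All increasing `(j+1)`-tuples of the sequence, projected to the first `j` coordinates,
have the same nonzero orientation. -/
def OrderTypeHomog {d n : ℕ} (j : ℕ) (p : Fin n → (Fin d → ℝ)) : Prop :=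
  (∀ t : Fin (j+1) → Fin n, StrictMono t → 0 < Dj j (fun a => p (t a))) ∨
  (∀ t : Fin (j+1) → Fin n, StrictMono t → Dj j (fun a => p (t a)) < 0)

/-- Super-order-type homogeneous sequence in `ℝ^d`. -/
def SuperOTHomog {d n : ℕ} (p : Fin n → (Fin d → ℝ)) : Prop :=
  ∀ j : ℕ, 1 ≤ j → j ≤ d → OrderTypeHomog j p

/-- Strong general position: for each `j ≤ d`, any `j+1` of the points projected to the first
`j` coordinates are affinely independent. -/
def StrongGenPos {d n : ℕ} (p : Fin n → (Fin d → ℝ)) : Prop :=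
  ∀ j : ℕ, 1 ≤ j → j ≤ d → ∀ t : Fin (j+1) → Fin n, StrictMono t →
    Dj j (fun a => p (t a)) ≠ 0

/-- One step of the `σδ` recursion (on `ℕ`-indexed coordinate vectors). -/
def sdelStep (x y : ℕ → ℝ) : ℕ → ℝ := fun t => (x (t+1) - y (t+1)) / (x 0 - y 0)

/-- `sdel m` is the map `σδ` on `m+1` points. -/
def sdel : (m : ℕ) → (Fin (m+1) → (ℕ → ℝ)) → (ℕ → ℝ)
  | 0, p => p 0
  | (m+1), p => sdelStep (sdel m (fun i => p i.castSucc)) (sdel m (fun i => p i.succ))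

/-- A point of `ℝ^d` as an `ℕ`-indexed coordinate vector (extended by 0). -/
def extv {d : ℕ} (x : Fin d → ℝ) : ℕ → ℝ := fun t => if h : t < d then x ⟨t, h⟩ else 0

/-- A finite point sequence as an `ℕ`-indexed family of coordinate vectors. -/
def pext {d n : ℕ} (p : Fin n → (Fin d → ℝ)) (i : ℕ) : ℕ → ℝ :=
  if h : i < n then extv (p ⟨i, h⟩) else fun _ => 0

/-- `win p j a = σδ(p_{a+1}, …, p_{a+j})` (with `a` 0-based). -/
def win {d n : ℕ} (p : Fin n → (Fin d → ℝ)) (j a : ℕ) : ℕ → ℝ :=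
  sdel (j - 1) (fun ℓ => pext p (a + (ℓ : ℕ)))

/-- Super-monotone sequence: for each `j ≤ d`, the sequence of the `σδ` of the windows of
`j` consecutive points is strictly monotone in the first coordinate. -/
def SuperMonotone {d n : ℕ} (p : Fin n → (Fin d → ℝ)) : Prop :=
  ∀ j : ℕ, 1 ≤ j → j ≤ d →
    ((∀ a b : ℕ, a + j ≤ n → b + j ≤ n → a < b → win p j a 0 < win p j b 0) ∨
     (∀ a b : ℕ, a + j ≤ n → b + j ≤ n → a < b → win p j b 0 < win p j a 0))

/-- `k`-monotone sequence. -/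
def kMonotone {d n : ℕ} (k : ℕ) (p : Fin n → (Fin d → ℝ)) : Prop :=
  ∀ j : ℕ, 1 ≤ j → j ≤ k →
    ((∀ a b : ℕ, a + j ≤ n → b + j ≤ n → a < b → win p j a 0 < win p j b 0) ∨
     (∀ a b : ℕ, a + j ≤ n → b + j ≤ n → a < b → win p j b 0 < win p j a 0))

/-- `k`-order-type homogeneous sequence. -/
def kOTHomog {d n : ℕ} (k : ℕ) (p : Fin n → (Fin d → ℝ)) : Prop :=
  ∀ j : ℕ, 1 ≤ j → j ≤ k → OrderTypeHomog j p

/-- Lexicographic strict order on binary vectors. -/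
def lexLt {N : ℕ} (α β : Fin N → Bool) : Prop :=
  ∃ i : Fin N, (α i = false ∧ β i = true) ∧ ∀ j : Fin N, j < i → α j = β j

/-- A tuple of binary vectors that is strictly increasing lexicographically. -/
def LexMono {N k : ℕ} (A : Fin k → (Fin N → Bool)) : Prop :=
  ∀ i j : Fin k, i < j → lexLt (A i) (A j)

/-- `dmin α β` = the (0-based) first index where `α` and `β` differ. -/
def dmin {N : ℕ} (α β : Fin N → Bool) : ℕ :=
  sInf {i : ℕ | ∃ h : i < N, α ⟨i, h⟩ ≠ β ⟨i, h⟩}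

/-- The stepping-up coloring `χ'` associated with a coloring `χ` of `k`-element subsets. -/
def stepUp {N : ℕ} (k : ℕ) (hk : 3 ≤ k) (χ : Finset ℕ → Fin 2)
    (A : Fin (k+1) → (Fin N → Bool)) : Fin 2 :=
  let δ : Fin k → ℕ := fun ℓ => dmin (A ℓ.castSucc) (A ℓ.succ)
  if StrictMono δ ∨ StrictAnti δ then χ (Finset.image δ Finset.univ)
  else if δ ⟨0, by omega⟩ < δ ⟨1, by omega⟩ ∧ δ ⟨2, by omega⟩ < δ ⟨1, by omega⟩ then 1
  else 0

/-- The point `q_α(ε) = Σ_i α_i ε^i (1, p_{i,1}, …, p_{i,d}) ∈ ℝ^{d+1}`. -/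
def qpt {d N : ℕ} (p : Fin N → (Fin d → ℝ)) (α : Fin N → Bool) (ε : ℝ) : Fin (d+1) → ℝ :=
  fun j => ∑ i : Fin N, (if α i then ε ^ ((i : ℕ) + 1) else 0) * (Fin.cons 1 (p i) : Fin (d+1) → ℝ) j

/-- The map `σδ : ℝ^{d+1} × ℝ^{d+1} → ℝ^d`. -/
def sdel2 {d : ℕ} (x y : Fin (d+1) → ℝ) : Fin d → ℝ :=
  fun j => (x j.succ - y j.succ) / (x 0 - y 0)

/-- The predicate `Ψ` built from `Φ` and `≺` in the semialgebraic stepping-up. -/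
def Psi {d : ℕ} (k : ℕ) (hk : 3 ≤ k) (Φ : (Fin k → (Fin d → ℝ)) → Prop)
    (prec : (Fin d → ℝ) → (Fin d → ℝ) → Prop)
    (x : Fin (k+1) → (Fin (d+1) → ℝ)) : Prop :=
  let s : Fin k → (Fin d → ℝ) := fun ℓ => sdel2 (x ℓ.castSucc) (x ℓ.succ)
  ((∀ ℓ : ℕ, ∀ h : ℓ + 1 < k, prec (s ⟨ℓ, by omega⟩) (s ⟨ℓ+1, h⟩)) ∧ Φ s) ∨
  ((∀ ℓ : ℕ, ∀ h : ℓ + 1 < k, prec (s ⟨ℓ+1, h⟩) (s ⟨ℓ, by omega⟩)) ∧ Φ (fun i => s i.rev)) ∨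
  (prec (s ⟨0, by omega⟩) (s ⟨1, by omega⟩) ∧ prec (s ⟨2, by omega⟩) (s ⟨1, by omega⟩))

/-- Determinant of the homogenized points. -/
def DD (P : ℕ → ℕ → ℝ) {m : ℕ} (t : Fin m → ℕ) : ℝ :=
  Matrix.det (Matrix.of (fun r i : Fin m => P (t i) (r : ℕ)))

/-- Top differing bit. -/
def TopBit (a b δ : ℕ) : Prop :=
  a.testBit δ = false ∧ b.testBit δ = true ∧ ∀ i, δ < i → a.testBit i = b.testBit i

lemma isTop_exists {a b : ℕ} (h : a < b) : ∃ δ, TopBit a b δ := by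
  have hne : a ^^^ b ≠ 0 := by
    intro h0
    rw [Nat.xor_eq_zero_iff] at h0
    omega
  obtain ⟨i, hi, hj⟩ := Nat.exists_most_significant_bit hne
  rw [Nat.testBit_xor] at hi
  have hag : ∀ j, i < j → a.testBit j = b.testBit j := by
    intro j hij
    have := hj j hij
    rw [Nat.testBit_xor] at this
    simpa using this
  refine ⟨i, ?_, ?_, hag⟩
  · by_contra hc
    have ha : a.testBit i = true := by simpa using hc
    have hb : b.testBit i = false := by simpa [ha] using hi
    have := Nat.lt_of_testBit i hb ha (fun j hj => (hag j hj).symm)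
    omega
  · by_contra hc
    have hb : b.testBit i = false := by simpa using hc
    have ha : a.testBit i = true := by simpa [hb] using hi
    have := Nat.lt_of_testBit i hb ha (fun j hj => (hag j hj).symm)
    omega

lemma TopBit.lt_of {a b δ N : ℕ} (h : TopBit a b δ) (hb : b < 2 ^ N) : δ < N := by
  by_contra hc
  have h1 : b < 2 ^ δ := lt_of_lt_of_le hb (Nat.pow_le_pow_right (by norm_num) (by omega))
  have := Nat.testBit_lt_two_pow h1
  rw [h.2.1] at this
  cases this

lemma TopBit.ne {a b c δ ε : ℕ} (h : TopBit a b δ) (h' : TopBit b c ε) : δ ≠ ε := by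
  rintro rfl
  have := h.2.1
  rw [h'.1] at this
  cases this

lemma TopBit.trans_lt {a b c δ ε : ℕ} (h : TopBit a b δ) (h' : TopBit b c ε) (hl : δ < ε) :
    TopBit a c ε :=
  ⟨(h.2.2 ε hl).trans h'.1, h'.2.1, fun i hi => (h.2.2 i (hl.trans hi)).trans (h'.2.2 i hi)⟩

lemma TopBit.trans_gt {a b c δ ε : ℕ} (h : TopBit a b δ) (h' : TopBit b c ε) (hl : ε < δ) :
    TopBit a c δ :=
  ⟨h.1, (h'.2.2 δ hl).symm.trans h.2.1, fun i hi => (h.2.2 i hi).trans (h'.2.2 i (hl.trans hi))⟩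

/-- The stepped-up points (homogenized). -/
def QQ (P : ℕ → ℕ → ℝ) (N : ℕ) (L : ℝ) (a : ℕ) : ℕ → ℝ
  | 0 => 1
  | r + 1 => ∑ i ∈ Finset.range N, (if a.testBit i then L ^ i else 0) * P i r

lemma DD_diff (Q : ℕ → ℕ → ℝ) (hQ : ∀ a, Q a 0 = 1) {m : ℕ} (t : Fin (m+1) → ℕ) :
    DD Q t = Matrix.det (Matrix.of (fun r i : Fin m =>
      Q (t i.succ) ((r : ℕ) + 1) - Q (t i.castSucc) ((r : ℕ) + 1))) := by
  unfold DD
  rw [Matrix.det_eq_of_forall_col_eq_smul_add_pred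
    (B := Matrix.of (fun (r i : Fin (m+1)) => (Fin.cases (Q (t 0) r)
      (fun k => Q (t k.succ) r - Q (t k.castSucc) r) i : ℝ))) (c := fun _ => 1)]
  · rw [Matrix.det_succ_row_zero, Fin.sum_univ_succ]
    simp [hQ]
    congr 1
  · intro i; simp
  · intro i j; simp

lemma tend_diff (P : ℕ → ℕ → ℝ) (N : ℕ) {a b δ : ℕ} (h : TopBit a b δ) (hδ : δ < N) (r : ℕ) :
    Filter.Tendsto (fun L : ℝ => (QQ P N L b (r+1) - QQ P N L a (r+1)) / L ^ δ) Filter.atTop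
      (nhds (P δ r)) := by
  have e : ∀ L : ℝ, (QQ P N L b (r+1) - QQ P N L a (r+1)) / L ^ δ
      = ∑ i ∈ Finset.range N, ((if b.testBit i then (1:ℝ) else 0) - (if a.testBit i then 1 else 0))
        * P i r * (L ^ i / L ^ δ) := by
    intro L
    simp only [QQ]
    rw [← Finset.sum_sub_distrib, Finset.sum_div]
    refine Finset.sum_congr rfl fun i _ => ?_
    split_ifs <;> ring
  have e2 : P δ r = ∑ i ∈ Finset.range N, if i = δ then P δ r else 0 := by
    simp [hδ]
  simp only [e]
  rw [e2]
  refine tendsto_finsetSum _ fun i _ => ?_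
  rcases lt_trichotomy i δ with hi | rfl | hi
  · rw [if_neg hi.ne]
    have := (tendsto_pow_div_pow_atTop_zero (𝕜 := ℝ) hi).const_mul
      (((if b.testBit i then (1:ℝ) else 0) - (if a.testBit i then 1 else 0)) * P i r)
    simpa using this
  · simp only [h.1, h.2.1, if_true]
    refine tendsto_const_nhds.congr' ?_
    filter_upwards [Filter.eventually_gt_atTop (0:ℝ)] with L hL
    have : L ^ i ≠ 0 := by positivity
    simp [div_self this]
  · rw [if_neg hi.ne', h.2.2 i hi]
    simp

lemma step_sign (P : ℕ → ℕ → ℝ) (N : ℕ) {m : ℕ} (t : Fin (m+1) → ℕ) (δ : Fin m → ℕ)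
    (hδ : ∀ i, δ i < N) (hT : ∀ i : Fin m, TopBit (t i.castSucc) (t i.succ) (δ i))
    (h0 : DD P δ ≠ 0) :
    ∀ᶠ L : ℝ in Filter.atTop, 0 < DD (QQ P N L) t * DD P δ := by
  have h1 : Filter.Tendsto (fun L : ℝ => Matrix.det (Matrix.of (fun r i : Fin m =>
      (QQ P N L (t i.succ) ((r : ℕ) + 1) - QQ P N L (t i.castSucc) ((r : ℕ) + 1)) / L ^ δ i)))
      Filter.atTop (nhds (DD P δ)) := by
    have hc : Continuous (fun M : Matrix (Fin m) (Fin m) ℝ => M.det) := continuous_id.matrix_det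
    refine (hc.tendsto _).comp ?_
    refine tendsto_pi_nhds.2 fun r => tendsto_pi_nhds.2 fun i => ?_
    exact tend_diff P N (hT i) (hδ i) r
  have h2 := (h1.mul_const (DD P δ)).eventually_const_lt (u := 0) (mul_self_pos.2 h0)
  filter_upwards [h2, Filter.eventually_gt_atTop (0:ℝ)] with L hL hL0
  rw [DD_diff _ (fun a => rfl)]
  have e := Matrix.det_mul_row (fun i : Fin m => L ^ δ i) (Matrix.of (fun r i : Fin m =>
      (QQ P N L (t i.succ) ((r : ℕ) + 1) - QQ P N L (t i.castSucc) ((r : ℕ) + 1)) / L ^ δ i))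
  have e2 : (Matrix.of fun r i : Fin m => L ^ δ i * (Matrix.of (fun r i : Fin m =>
      (QQ P N L (t i.succ) ((r : ℕ) + 1) - QQ P N L (t i.castSucc) ((r : ℕ) + 1)) / L ^ δ i)) r i)
      = Matrix.of (fun r i : Fin m =>
      (QQ P N L (t i.succ) ((r : ℕ) + 1) - QQ P N L (t i.castSucc) ((r : ℕ) + 1))) := by
    ext r i
    have : L ^ δ i ≠ 0 := by positivity
    simp only [Matrix.of_apply]
    field_simp
  rw [e2] at e
  rw [e, mul_assoc]
  exact mul_pos (Finset.prod_pos fun i _ => by positivity) hL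

lemma exists_L (P : ℕ → ℕ → ℝ) (N K : ℕ) : ∃ Q : ℕ → ℕ → ℝ, (∀ a, Q a 0 = 1) ∧
    ∀ m ≤ K, ∀ (t : Fin (m+1) → ℕ) (δ : Fin m → ℕ), (∀ i, t i < 2 ^ N) → (∀ i, δ i < N) →
      (∀ i : Fin m, TopBit (t i.castSucc) (t i.succ) (δ i)) → DD P δ ≠ 0 →
      0 < DD Q t * DD P δ := by
  have : ∀ᶠ L : ℝ in Filter.atTop, ∀ m : Fin (K+1), ∀ (t : Fin ((m:ℕ)+1) → Fin (2^N))
      (δ : Fin (m:ℕ) → Fin N),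
      (∀ i : Fin (m:ℕ), TopBit (t i.castSucc) (t i.succ) (δ i)) → DD P (fun i => (δ i : ℕ)) ≠ 0 →
      0 < DD (QQ P N L) (fun i => (t i : ℕ)) * DD P (fun i => (δ i : ℕ)) := by
    refine Filter.eventually_all.2 fun m => Filter.eventually_all.2 fun t =>
      Filter.eventually_all.2 fun δ => ?_
    refine Filter.eventually_imp_distrib_left.2 fun h => Filter.eventually_imp_distrib_left.2
      fun h0 => ?_
    exact step_sign P N _ _ (fun i => (δ i).2) h h0
  obtain ⟨L, hL⟩ := this.exists
  refine ⟨QQ P N L, fun a => rfl, fun m hm t δ ht hδ hT h0 => ?_⟩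
  exact hL ⟨m, by omega⟩ (fun i => ⟨t i, ht i⟩) (fun i => ⟨δ i, hδ i⟩) hT h0

lemma DD_vander {m : ℕ} (t : Fin m → ℕ) (ht : StrictMono t) :
    DD (fun a r => (a : ℝ) ^ r) t ≠ 0 := by
  have : DD (fun a r => (a : ℝ) ^ r) t = (Matrix.vandermonde (fun i => (t i : ℝ))).det := by
    rw [← Matrix.det_transpose]
    rfl
  rw [this, Matrix.det_vandermonde_ne_zero_iff]
  exact Nat.cast_injective.comp ht.injective

lemma perturb_one (Q : ℕ → ℕ → ℝ) {m : ℕ} (t : Fin m → ℕ) (ht : StrictMono t) :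
    ∀ᶠ s : ℝ in nhdsWithin 0 {0}ᶜ,
      DD (fun a r => (1 - s) * Q a r + s * (a : ℝ) ^ r) t ≠ 0 ∧
      ∀ x, 0 < DD Q t * x → 0 < DD (fun a r => (1 - s) * Q a r + s * (a : ℝ) ^ r) t * x := by
  obtain ⟨f, hf⟩ : ∃ f : Polynomial ℝ, ∀ s,
      f.eval s = DD (fun a r => (1 - s) * Q a r + s * (a : ℝ) ^ r) t := by
    refine ⟨Matrix.det (Matrix.of (fun r i : Fin m =>
      (1 - Polynomial.X) * Polynomial.C (Q (t i) r)
        + Polynomial.X * Polynomial.C ((t i : ℝ) ^ (r : ℕ)))), fun s => ?_⟩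
    rw [← Polynomial.coe_evalRingHom, RingHom.map_det]
    unfold DD
    congr 1
    ext r i
    simp [RingHom.mapMatrix_apply, Matrix.map_apply]
  have hf0 : f.eval 0 = DD Q t := by rw [hf]; simp
  have hf1 : f.eval 1 ≠ 0 := by
    rw [hf]; simpa using DD_vander t ht
  have hne : f ≠ 0 := by rintro rfl; simp at hf1
  simp only [← hf]
  refine Filter.Eventually.and ?_ ?_
  · have hfin : {s | f.IsRoot s}.Finite := Polynomial.finite_setOfPred_isRoot hne
    have : (({s | f.IsRoot s} \ {0})ᶜ : Set ℝ) ∈ nhds (0:ℝ) :=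
      (hfin.subset Set.sdiff_subset).isClosed.isOpen_compl.mem_nhds (by simp)
    filter_upwards [mem_nhdsWithin_of_mem_nhds this, self_mem_nhdsWithin] with s hs hs0 h
    exact hs ⟨h, hs0⟩
  · apply Filter.Eventually.filter_mono nhdsWithin_le_nhds
    have hc : Filter.Tendsto (fun s => f.eval s) (nhds 0) (nhds (DD Q t)) := by
      rw [← hf0]; exact f.continuous.tendsto 0
    rcases lt_trichotomy (DD Q t) 0 with h | h | h
    · filter_upwards [hc.eventually_lt_const h] with s hs x hx
      exact mul_pos_of_neg_of_neg hs (neg_of_mul_pos_right hx h.le)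
    · rw [h]; simp
    · filter_upwards [hc.eventually_const_lt h] with s hs x hx
      exact mul_pos hs (pos_of_mul_pos_right hx h.le)

lemma perturb (Q : ℕ → ℕ → ℝ) (hQ : ∀ a, Q a 0 = 1) (M K : ℕ) :
    ∃ Q' : ℕ → ℕ → ℝ, (∀ a, Q' a 0 = 1) ∧
      ∀ m ≤ K, ∀ t : Fin m → ℕ, StrictMono t → (∀ i, t i < M) →
        DD Q' t ≠ 0 ∧ ∀ x, 0 < DD Q t * x → 0 < DD Q' t * x := by
  have : ∀ᶠ s : ℝ in nhdsWithin 0 {0}ᶜ, ∀ m : Fin (K+1), ∀ t : Fin (m:ℕ) → Fin M,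
      StrictMono (fun i => (t i : ℕ)) →
      DD (fun a r => (1 - s) * Q a r + s * (a : ℝ) ^ r) (fun i => (t i : ℕ)) ≠ 0 ∧
      ∀ x, 0 < DD Q (fun i => (t i : ℕ)) * x →
        0 < DD (fun a r => (1 - s) * Q a r + s * (a : ℝ) ^ r) (fun i => (t i : ℕ)) * x := by
    refine Filter.eventually_all.2 fun m => Filter.eventually_all.2 fun t => ?_
    refine Filter.eventually_imp_distrib_left.2 fun h => ?_
    exact perturb_one Q _ h
  obtain ⟨s, hs⟩ := this.exists
  refine ⟨_, fun a => ?_, fun m hm t ht htM => hs ⟨m, by omega⟩ (fun i => ⟨t i, htM i⟩) ht⟩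
  simp [hQ]

/-- The internal induction statement. -/
def Key (d N n : ℕ) : Prop :=
  ∃ P : ℕ → ℕ → ℝ, (∀ i, P i 0 = 1) ∧ (∀ i k, i < k → k < N → P i 1 < P k 1) ∧
    (∀ m ≤ d + 1, ∀ t : Fin m → ℕ, StrictMono t → (∀ i, t i < N) → DD P t ≠ 0) ∧
    ∀ g : ℕ → ℕ, (∀ i k, i < k → k < n → g i < g k) → (∀ i < n, g i < N) →
      ∀ s : ℕ → ℝ, ¬ ∀ m ≤ d + 1, ∀ t : Fin m → ℕ, StrictMono t → (∀ i, t i < n) →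
        0 < s m * DD P (fun i => g (t i))

lemma key_base (n : ℕ) (hn : 1 ≤ n) : Key 1 (n - 1) n := by
  refine ⟨fun a r => (a : ℝ) ^ r, by simp, ?_, ?_, ?_⟩
  · intro i k h _; simpa using h
  · intro m _ t ht _; exact DD_vander t ht
  · intro g hg hN s _
    have : ∀ i < n, i ≤ g i := by
      intro i
      induction i with
      | zero => simp
      | succ i ih =>
        intro h
        have := hg i (i+1) (by omega) h
        have := ih (by omega)
        omega
    have h1 := this (n-1) (by omega)
    have h2 := hN (n-1) (by omega)
    omega

lemma DD_rev (P : ℕ → ℕ → ℝ) {m : ℕ} (t : Fin m → ℕ) :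
    DD P (fun i => t i.rev) = ((Equiv.Perm.sign (Fin.revPerm : Equiv.Perm (Fin m)) : ℤ) : ℝ) * DD P t := by
  have := Matrix.det_permute' (Fin.revPerm : Equiv.Perm (Fin m))
    (Matrix.of (fun r i : Fin m => P (t i) (r : ℕ)))
  exact this

lemma sm_two {a b : ℕ} (h : a < b) : StrictMono ![a, b] := by
  rw [Fin.strictMono_iff_lt_succ]
  intro i
  fin_cases i
  exact h

lemma sm_three (a : ℕ) : StrictMono ![a, a+1, a+2] := by
  rw [Fin.strictMono_iff_lt_succ]
  intro i
  fin_cases i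
  · exact Nat.lt_succ_self a
  · exact Nat.lt_succ_self (a+1)

set_option maxHeartbeats 1000000 in
lemma key_step (d N n : ℕ) (hd : 1 ≤ d) (h : Key d N n) : Key (d+1) (2 ^ N) (n+1) := by
  obtain ⟨P, hP0, hP1, hPg, hPn⟩ := h
  obtain ⟨Q₀, hQ₀, hQA₀⟩ := exists_L P N (d+1)
  obtain ⟨Q, hQ0, hQ⟩ := perturb Q₀ hQ₀ (2 ^ N) (d+2)
  have hQA : ∀ m ≤ d+1, ∀ (t : Fin (m+1) → ℕ) (δ : Fin m → ℕ), StrictMono t →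
      (∀ i, t i < 2 ^ N) → (∀ i, δ i < N) →
      (∀ i : Fin m, TopBit (t i.castSucc) (t i.succ) (δ i)) → DD P δ ≠ 0 →
      0 < DD Q t * DD P δ := fun m hm t δ ht htN hδ hT h0 =>
    (hQ (m+1) (by omega) t ht htN).2 _ (hQA₀ m hm t δ htN hδ hT h0)
  have hD2 : ∀ (R : ℕ → ℕ → ℝ), (∀ i, R i 0 = 1) → ∀ a b, DD R ![a, b] = R b 1 - R a 1 := by
    intro R hR a b
    simp [DD, Matrix.det_fin_two, hR]
  have hD1 : ∀ (R : ℕ → ℕ → ℝ), (∀ i, R i 0 = 1) → ∀ a, DD R ![a] = 1 := by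
    intro R hR a
    simp [DD, hR]
  refine ⟨Q, hQ0, ?_, fun m hm t ht htN => (hQ m hm t ht htN).1, ?_⟩
  · intro i k hik hk
    obtain ⟨δ, hδ⟩ := isTop_exists hik
    have := hQA 1 (by omega) ![i, k] ![δ] (sm_two hik)
      (by intro a; fin_cases a <;> simp <;> omega)
      (by intro a; fin_cases a; simpa using hδ.lt_of hk)
      (by intro a; fin_cases a; simpa using hδ)
      (by rw [hD1 P hP0]; norm_num)
    rw [hD1 P hP0, hD2 Q hQ0] at this
    linarith
  · intro g hg hgN s hs
    have hex : ∀ i, ∃ δ, i < n → TopBit (g i) (g (i+1)) δ := by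
      intro i
      by_cases hi : i < n
      · obtain ⟨δ, hδ⟩ := isTop_exists (hg i (i+1) (by omega) (by omega))
        exact ⟨δ, fun _ => hδ⟩
      · exact ⟨0, fun h => absurd h hi⟩
    choose δ hδ using hex
    have hδN : ∀ i < n, δ i < N := fun i hi => (hδ i hi).lt_of (hgN _ (by omega))
    have hgm : ∀ {m : ℕ} (t : Fin m → ℕ), StrictMono t → (∀ i, t i < n + 1) →
        StrictMono (fun i => g (t i)) := fun t ht htn a b hab => hg _ _ (ht hab) (htn b)
    have hmono : ∀ i, i + 1 < n → 0 < s 3 * (P (δ (i+1)) 1 - P (δ i) 1) := by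
      intro i hi
      have hne := (hδ i (by omega)).ne (hδ (i+1) hi)
      have hne' : P (δ (i+1)) 1 - P (δ i) 1 ≠ 0 := by
        rcases lt_or_gt_of_ne hne with h | h
        · have := hP1 _ _ h (hδN _ hi)
          exact sub_ne_zero.2 this.ne'
        · have := hP1 _ _ h (hδN _ (by omega))
          exact sub_ne_zero.2 this.ne
      have htm : StrictMono ![i, i+1, i+2] := sm_three i
      have htn : ∀ a, ![i, i+1, i+2] a < n + 1 := by
        intro a; fin_cases a <;> simp <;> omega
      have h1 := hQA 2 (by omega) (fun a => g (![i, i+1, i+2] a)) ![δ i, δ (i+1)]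
        (hgm _ htm htn) (fun a => hgN _ (htn a))
        (by intro a; fin_cases a
            · simpa using hδN i (by omega)
            · simpa using hδN (i+1) (by omega))
        (by intro a; fin_cases a
            · exact hδ i (by omega)
            · exact hδ (i+1) (by omega))
        (by rw [hD2 P hP0]; exact hne')
      have h2 := hs 3 (by omega) _ htm htn
      rw [hD2 P hP0] at h1
      have h3 := mul_pos h2 h1
      have h4 : 0 < (s 3 * (P (δ (i+1)) 1 - P (δ i) 1)) * (DD Q (fun a => g (![i, i+1, i+2] a)))^2 := by
        nlinarith
      exact pos_of_mul_pos_left h4 (sq_nonneg _)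
    have hfin : ∀ m ≤ d+1, ∀ (t : Fin (m+1) → ℕ) (e : Fin m → ℕ), StrictMono t →
        (∀ i, t i < n + 1) → (∀ i, e i < N) →
        (∀ i : Fin m, TopBit (g (t i.castSucc)) (g (t i.succ)) (e i)) → DD P e ≠ 0 →
        0 < s (m+1) * DD P e := by
      intro m hm t e ht htn heN hT h0
      have h1 := hQA m hm (fun i => g (t i)) e (hgm t ht htn) (fun i => hgN _ (htn i)) heN hT h0
      have h2 := hs (m+1) (by omega) t ht htn
      have h3 := mul_pos h2 h1
      have h4 : 0 < (s (m+1) * DD P e) * (DD Q (fun i => g (t i)))^2 := by nlinarith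
      exact pos_of_mul_pos_left h4 (sq_nonneg _)
    rcases lt_or_ge 0 (s 3) with hs3 | hs3
    · have hinc : ∀ i, i + 1 < n → δ i < δ (i+1) := by
        intro i hi
        have h1 := pos_of_mul_pos_right (hmono i hi) hs3.le
        by_contra hc
        have hne := (hδ i (by omega)).ne (hδ (i+1) hi)
        have := hP1 _ _ (show δ (i+1) < δ i by omega) (hδN _ (by omega))
        linarith
      have hinc' : ∀ i k, i < k → k < n → δ i < δ k := by
        intro i k hik
        induction k, hik using Nat.le_induction with
        | base => exact hinc i
        | succ k hk ih =>
          intro h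
          exact (ih (by omega)).trans (hinc k h)
      have htop : ∀ i k, i ≤ k → k < n → TopBit (g i) (g (k+1)) (δ k) := by
        intro i k hik
        induction k, hik using Nat.le_induction with
        | base => exact hδ i
        | succ k hk ih =>
          intro h
          exact (ih (by omega)).trans_lt (hδ (k+1) h) (hinc k h)
      refine hPn δ hinc' hδN (fun m => s (m+1)) fun m hm t ht htn => ?_
      refine hfin m hm (Fin.cons 0 (fun i => t i + 1)) (fun i => δ (t i)) ?_ ?_
        (fun i => hδN _ (htn i)) ?_ (hPg m hm _ (fun a b hab => hinc' _ _ (ht hab) (htn b))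
          (fun i => hδN _ (htn i)))
      · intro a b hab
        induction b using Fin.cases with
        | zero => simp at hab
        | succ b =>
          induction a using Fin.cases with
          | zero => simp
          | succ a => simpa using ht (Fin.succ_lt_succ_iff.1 hab)
      · intro a
        induction a using Fin.cases with
        | zero => simp
        | succ a => simpa using htn a
      · intro i
        rw [Fin.cons_succ]
        apply htop _ _ _ (htn i)
        obtain ⟨i, hi⟩ := i
        cases i with
        | zero => simp
        | succ i =>
          have : (Fin.castSucc ⟨i+1, hi⟩ : Fin (m+1)) = Fin.succ ⟨i, by omega⟩ := rfl
          rw [this, Fin.cons_succ]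
          exact ht (by simp)
    · have hdec : ∀ i, i + 1 < n → δ (i+1) < δ i := by
        intro i hi
        have h1 := neg_of_mul_pos_right (hmono i hi) hs3
        by_contra hc
        have hne := (hδ i (by omega)).ne (hδ (i+1) hi)
        have := hP1 _ _ (show δ i < δ (i+1) by omega) (hδN _ (by omega))
        linarith
      have hdec' : ∀ i k, i < k → k < n → δ k < δ i := by
        intro i k hik
        induction k, hik using Nat.le_induction with
        | base => exact hdec i
        | succ k hk ih =>
          intro h
          exact (hdec k h).trans (ih (by omega))
      have htop : ∀ i k, i < k → k < n + 1 → TopBit (g i) (g k) (δ i) := by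
        intro i k hik
        induction k, hik using Nat.le_induction with
        | base => intro h; exact hδ i (by omega)
        | succ k hk ih =>
          intro h
          exact (ih (by omega)).trans_gt (hδ k (by omega)) (hdec' i k hk (by omega))
      refine hPn (fun i => δ (n - 1 - i)) (fun i k hik hk => hdec' _ _ (by omega) (by omega))
        (fun i hi => hδN _ (by omega))
        (fun m => s (m+1) * ((Equiv.Perm.sign (Fin.revPerm : Equiv.Perm (Fin m)) : ℤ) : ℝ))
        fun m hm t ht htn => ?_
      have hnz := hPg m hm (fun i => δ (n - 1 - t i))
        (fun a b hab => hdec' _ _ (by have := ht hab; have := htn b; omega)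
          (by have := htn a; omega))
        (fun i => hδN _ (by have := htn i; omega))
      have hrev := DD_rev P (fun i => δ (n - 1 - t i))
      rw [mul_assoc, ← hrev]
      have hum : StrictMono (fun i : Fin m => n - 1 - t i.rev) := by
        intro a b hab
        have h1 := ht (Fin.rev_lt_rev.2 hab)
        have h2 := htn a.rev
        simp only
        omega
      have hun : ∀ i : Fin m, n - 1 - t i.rev < n := fun i => by
        have := htn i.rev
        omega
      refine hfin m hm (Fin.snoc (fun i : Fin m => n - 1 - t i.rev) n) _ ?_ ?_
        (fun i => hδN _ (hun i)) ?_ ?_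
      · intro a b hab
        induction a using Fin.lastCases with
        | last => exact absurd hab (not_lt.2 (Fin.le_last b))
        | cast a =>
          induction b using Fin.lastCases with
          | last => simpa using hun a
          | cast b => simpa using hum (Fin.castSucc_lt_castSucc_iff.1 hab)
      · intro a
        induction a using Fin.lastCases with
        | last => simp
        | cast a => have := hun a; simp only [Fin.snoc_castSucc]; omega
      · intro i
        rw [Fin.snoc_castSucc]
        apply htop
        · by_cases hi : (i : ℕ) + 1 < m
          · have : i.succ = Fin.castSucc ⟨i+1, hi⟩ := rfl
            rw [this, Fin.snoc_castSucc]
            exact hum (by rw [Fin.lt_def]; simp)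
          · have : i.succ = Fin.last m := by ext; simp; omega
            rw [this, Fin.snoc_last]
            exact hun i
        · by_cases hi : (i : ℕ) + 1 < m
          · have : i.succ = Fin.castSucc ⟨i+1, hi⟩ := rfl
            rw [this, Fin.snoc_castSucc]
            have := hun ⟨i+1, hi⟩
            omega
          · have : i.succ = Fin.last m := by ext; simp; omega
            rw [this, Fin.snoc_last]
            omega
      · rw [hrev]
        exact mul_ne_zero (by simp) hnz

lemma key_all (d : ℕ) (hd : 1 ≤ d) : ∀ n, d + 1 ≤ n → Key d (twr d (n - d)) n := by
  induction d, hd using Nat.le_induction with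
  | base => intro n hn; exact key_base n (by omega)
  | succ d hd ih =>
    intro n hn
    obtain ⟨n, rfl⟩ : ∃ k, n = k + 1 := ⟨n - 1, by omega⟩
    have h := key_step d _ n hd (ih n (by omega))
    obtain ⟨e, rfl⟩ : ∃ e, d = e + 1 := ⟨d - 1, by omega⟩
    have e1 : n + 1 - (e + 1 + 1) = n - (e + 1) := by omega
    rw [e1]
    exact h

lemma Dj_eq {d N : ℕ} (P : ℕ → ℕ → ℝ) (hP : ∀ i, P i 0 = 1) (j : ℕ) (hj : 1 ≤ j) (hjd : j ≤ d)
    (t : Fin (j+1) → Fin N) :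
    Dj j (fun a => (fun (r : Fin d) => P (t a) ((r : ℕ) + 1))) = DD P (fun a => (t a : ℕ)) := by
  unfold Dj DD
  congr 1
  ext r i
  simp only [Matrix.of_apply, coordE]
  have := r.2
  split_ifs with h1 h2 h3 h4
  · congr 1; omega
  · omega
  · rw [h3, hP]
  · congr 1; omega
  · omega


/-- For every `d ≥ 1` and `n ≥ d+1` there is a sequence of `twr d (n-d)` points
in strong general position in `ℝ^d` with no super-order-type homogeneous subsequence of
length `n`; consequently `OT*_d(n) ≥ twr_d(n-d)`. -/
theorem superOT_lower_bound (d n : ℕ) (hd : 1 ≤ d) (hn : d + 1 ≤ n) :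
    ∃ p : Fin (twr d (n - d)) → (Fin d → ℝ),
      StrongGenPos p ∧
      ¬ ∃ g : Fin n → Fin (twr d (n - d)),
          StrictMono g ∧ SuperOTHomog (fun i => p (g i)) := by
  obtain ⟨P, hP0, -, hPg, hPn⟩ := key_all d hd n hn
  refine ⟨fun i r => P i ((r : ℕ) + 1), ?_, ?_⟩
  · intro j hj hjd t ht
    rw [Dj_eq P hP0 j hj hjd]
    exact hPg (j+1) (by omega) _ ht (fun i => (t i).2)
  · rintro ⟨g, hg, hS⟩
    have hex : ∀ m, ∃ s : ℝ, m ≤ d + 1 → ∀ t : Fin m → Fin n, StrictMono t →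
        0 < s * DD P (fun i => (g (t i) : ℕ)) := by
      intro m
      by_cases hm : m ≤ d + 1
      · rcases m with _ | _ | j
        · exact ⟨1, fun _ t _ => by simp [DD]⟩
        · exact ⟨1, fun _ t _ => by simp [DD, hP0]⟩
        · rcases hS (j+1) (by omega) (by omega) with h | h
          · refine ⟨1, fun _ t ht => ?_⟩
            have := h t ht
            rw [Dj_eq P hP0 (j+1) (by omega) (by omega) (fun a => g (t a))] at this
            linarith
          · refine ⟨-1, fun _ t ht => ?_⟩
            have := h t ht
            rw [Dj_eq P hP0 (j+1) (by omega) (by omega) (fun a => g (t a))] at this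
            linarith
      · exact ⟨0, fun h => absurd h hm⟩
    choose s hs using hex
    have hG : ∀ i, ∀ hi : i < n,
        (if h : i < n then (g ⟨i, h⟩ : ℕ) else 0) = g ⟨i, hi⟩ := fun i hi => dif_pos hi
    refine hPn (fun i => if h : i < n then (g ⟨i, h⟩ : ℕ) else 0) ?_ ?_ s ?_
    · intro i k hik hk
      simp only [hG i (hik.trans hk), hG k hk]
      exact hg hik
    · intro i hi
      simp only [hG i hi]
      exact (g ⟨i, hi⟩).2
    · intro m hm t ht htn
      have := hs m hm (fun i => ⟨t i, htn i⟩) ht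
      simpa only [hG _ (htn _)] using this

end
end

section
/- For every integer d ≥ 1 there exist a constant c > 0 and an integer n_0 such that for every n ≥ n_0 there is a sequence of ⌊twr_d(c·n)⌋ points in general position in ℝ^d (no d + 1 of the points lie on a common hyperplane) that contains no order-type homogeneous subsequence of length n. Consequently the Ramsey function OT_d satisfies OT_d(n) ≥ twr_d(Ω(n)). -/
open scoped Classical

noncomputable section

namespace OTP


def D (k : ℕ) (v : Fin (k+1) → ℕ → ℝ) : ℝ := Matrix.det (Matrix.of fun i j : Fin (k+1) => v j i)

/-- linear functional obtained by expanding along the missing column -/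
def F (k : ℕ) (o : Fin k → ℕ → ℝ) (w : ℕ → ℝ) : ℝ :=
  ∑ i : Fin (k+1), (-1 : ℝ)^(i:ℕ) * w i * Matrix.det (Matrix.of fun a b : Fin k => o b (i.succAbove a))

lemma D_eq_F (k : ℕ) (v : Fin (k+1) → ℕ → ℝ) (r : Fin (k+1)) :
    D k v = (-1 : ℝ)^(r:ℕ) * F k (fun i => v (r.succAbove i)) (v r) := by
  unfold D F
  rw [Matrix.det_succ_column _ r, Finset.mul_sum]
  refine Finset.sum_congr rfl fun i _ => ?_
  have : (Matrix.of fun i j : Fin (k+1) => v j i).submatrix i.succAbove r.succAbove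
    = Matrix.of fun a b : Fin k => v (r.succAbove b) (i.succAbove a) := by
    ext a b; simp
  rw [this, pow_add]; simp only [Matrix.of_apply]; ring

lemma F_zero (k : ℕ) (o : Fin k → ℕ → ℝ) (i : Fin k) : F k o (o i) = 0 := by
  have h := D_eq_F k (Fin.cons (o i) o : Fin (k+1) → ℕ → ℝ) 0
  simp only [Fin.val_zero, pow_zero, one_mul, Fin.cons_zero, Fin.zero_succAbove, Fin.cons_succ] at h
  rw [← h]
  unfold D
  refine Matrix.det_zero_of_column_eq (i := 0) (j := i.succ) (Fin.succ_ne_zero i).symm ?_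
  intro a; simp

lemma relation (k : ℕ) (T : Fin (k+2) → ℕ → ℝ) (a : ℕ) (ha : a < k + 1) :
    ∑ i : Fin (k+2), (-1 : ℝ)^(i:ℕ) * T i a * D k (fun j => T (i.succAbove j)) = 0 := by
  have h : Matrix.det (Matrix.of (Fin.cons (fun j => T j a) (fun (i : Fin (k+1)) j => T j i)
      : Fin (k+2) → Fin (k+2) → ℝ)) = 0 := by
    refine Matrix.det_zero_of_row_eq (i := 0) (j := (⟨a, ha⟩ : Fin (k+1)).succ) (Fin.succ_ne_zero _).symm ?_
    ext j; simp only [Matrix.of_apply, Fin.cons_zero, Fin.cons_succ]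
  rw [Matrix.det_succ_row_zero] at h
  rw [← h]
  refine Finset.sum_congr rfl fun i _ => ?_
  unfold D
  congr 1

lemma relationF (k : ℕ) (T : Fin (k+3) → ℕ → ℝ) (o : Fin k → ℕ → ℝ) :
    ∑ i : Fin (k+3), (-1 : ℝ)^(i:ℕ) * F k o (T i) * D (k+1) (fun j => T (i.succAbove j)) = 0 := by
  unfold F
  simp only [Finset.mul_sum, Finset.sum_mul]
  rw [Finset.sum_comm]
  refine Finset.sum_eq_zero fun a _ => ?_
  have h := relation (k+1) T a (by omega)
  calc _ = (-1 : ℝ)^(a:ℕ) * Matrix.det (Matrix.of fun x b : Fin k => o b (a.succAbove x)) *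
      ∑ i : Fin (k+3), (-1 : ℝ)^(i:ℕ) * T i a * D (k+1) (fun j => T (i.succAbove j)) := by
        rw [Finset.mul_sum]; refine Finset.sum_congr rfl fun i _ => ?_; ring
    _ = 0 := by rw [h, mul_zero]

lemma plucker (k : ℕ) (T : Fin (k+3) → ℕ → ℝ) (r : Fin (k+1)) :
    D k (fun i => T i.castSucc.succ) * D (k+1) (fun j => T (r.castSucc.succ.succAbove j)) =
    D k (Fin.cons (T 0) (fun i => T (r.succAbove i).castSucc.succ)) *
      D (k+1) (fun j => T (Fin.succAbove 0 j)) +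
    D k (Fin.snoc (fun i => T (r.succAbove i).castSucc.succ) (T (Fin.last _))) *
      D (k+1) (fun j => T (Fin.succAbove (Fin.last _) j)) := by
  set o : Fin k → ℕ → ℝ := fun i => T (r.succAbove i).castSucc.succ with ho
  have h := relationF k T o
  rw [Fin.sum_univ_succ, Fin.sum_univ_castSucc, Finset.sum_eq_single r] at h
  · have e1 := D_eq_F k (fun i => T i.castSucc.succ) r
    have e2 := D_eq_F k (Fin.cons (T 0) o : Fin (k+1) → ℕ → ℝ) 0
    have e3 := D_eq_F k (Fin.snoc o (T (Fin.last _)) : Fin (k+1) → ℕ → ℝ) (Fin.last _)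
    simp only [Fin.val_zero, pow_zero, one_mul, Fin.cons_zero, Fin.zero_succAbove, Fin.cons_succ,
      Fin.succAbove_last, Fin.snoc_castSucc, Fin.snoc_last, Fin.val_last] at e2 e3
    simp only [Fin.val_zero, pow_zero, one_mul, Fin.val_succ, Fin.val_castSucc, Fin.val_last,
      Fin.succ_last] at h
    rw [e1, e2, e3]
    rw [← ho]
    have : ((-1:ℝ))^(k+1+1) = (-1)^k := by rw [pow_add, pow_add]; norm_num
    rw [this] at h
    rw [pow_succ] at h
    simp only [Nat.succ_eq_add_one] at *
    linarith
  · intro b _ hb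
    obtain ⟨b', rfl⟩ := Fin.exists_succAbove_eq hb
    have := F_zero k o b'
    rw [ho] at this
    simp only at this
    rw [ho, this]; simp
  · simp



def PreHom (k : ℕ) (c : Finset ℕ → Prop) (T : Finset ℕ) : Prop :=
  ∃ φ : ℕ → Prop, ∀ x ∈ T, ∀ U ⊆ T, U.card = k → (∀ y ∈ U, x < y) → (c (insert x U) ↔ φ x)

lemma ramsey_pre (k : ℕ)
    (ih : ∀ n : ℕ, ∃ K : ℕ, ∀ (c : Finset ℕ → Prop) (S : Finset ℕ), K ≤ S.card →
      ∃ T ⊆ S, T.card = n ∧ ∃ P : Prop, ∀ U ⊆ T, U.card = k → (c U ↔ P)) (m : ℕ) :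
    ∃ K : ℕ, ∀ (c : Finset ℕ → Prop) (S : Finset ℕ), K ≤ S.card →
      ∃ T ⊆ S, T.card = m ∧ PreHom k c T := by
  induction m with
  | zero => exact ⟨0, fun c S _ => ⟨∅, by simp, rfl, fun _ => True, by simp⟩⟩
  | succ m ihm =>
    obtain ⟨K, hK⟩ := ihm
    obtain ⟨K', hK'⟩ := ih K
    refine ⟨K' + 1, fun c S hS => ?_⟩
    have hne : S.Nonempty := by rw [← Finset.card_pos]; omega
    set x := S.min' hne with hx
    have hxS : x ∈ S := Finset.min'_mem _ _
    have hcard : K' ≤ (S.erase x).card := by rw [Finset.card_erase_of_mem hxS]; omega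
    obtain ⟨T, hT, hTc, P, hP⟩ := hK' (fun U => c (insert x U)) _ hcard
    obtain ⟨T', hT', hTc', φ, hφ⟩ := hK c T hTc.ge
    have hlt : ∀ y ∈ T', x < y := by
      intro y hy
      have h1 := hT (hT' hy)
      rw [Finset.mem_erase] at h1
      exact lt_of_le_of_ne (Finset.min'_le _ _ h1.2) (Ne.symm h1.1)
    have hxT' : x ∉ T' := fun h => lt_irrefl _ (hlt x h)
    refine ⟨insert x T', ?_, ?_, fun y => if y = x then P else φ y, ?_⟩
    · intro y hy
      rcases Finset.mem_insert.1 hy with rfl | h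
      · exact hxS
      · exact Finset.mem_of_mem_erase (hT (hT' h))
    · rw [Finset.card_insert_of_notMem hxT', hTc']
    · intro y hy U hU hUc hyU
      by_cases hyx : y = x
      · subst hyx
        beta_reduce
        rw [if_pos rfl]
        refine hP U (fun z hz => ?_) hUc
        rcases Finset.mem_insert.1 (hU hz) with h | h
        · exact absurd (hyU z hz) (by rw [h]; exact lt_irrefl _)
        · exact hT' h
      · beta_reduce
        rw [if_neg hyx]
        have hyT : y ∈ T' := (Finset.mem_insert.1 hy).resolve_left hyx
        refine hφ y hyT U (fun z hz => ?_) hUc hyU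
        rcases Finset.mem_insert.1 (hU hz) with h | h
        · have h1 := hyU z hz
          have h2 := hlt y hyT
          omega
        · exact h

lemma ramsey (k : ℕ) : ∀ n : ℕ, ∃ K : ℕ, ∀ (c : Finset ℕ → Prop) (S : Finset ℕ), K ≤ S.card →
      ∃ T ⊆ S, T.card = n ∧ ∃ P : Prop, ∀ U ⊆ T, U.card = k → (c U ↔ P) := by
  induction k with
  | zero =>
    intro n
    refine ⟨n, fun c S hS => ?_⟩
    obtain ⟨T, hT, hc⟩ := Finset.exists_subset_card_eq hS
    refine ⟨T, hT, hc, c ∅, fun U _ hU => ?_⟩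
    rw [Finset.card_eq_zero.1 hU]
  | succ k ih =>
    intro n
    obtain ⟨K, hK⟩ := ramsey_pre k ih (2 * n)
    refine ⟨K, fun c S hS => ?_⟩
    obtain ⟨T, hT, hTc, φ, hφ⟩ := hK c S hS
    have key : ∀ U ⊆ T, U.card = k + 1 → ∃ x ∈ U, (c U ↔ φ x) := by
      intro U hU hUc
      have hne : U.Nonempty := by rw [← Finset.card_pos]; omega
      have hm := U.min'_mem hne
      refine ⟨U.min' hne, hm, ?_⟩
      have := hφ (U.min' hne) (hU hm) (U.erase (U.min' hne))
        ((Finset.erase_subset _ _).trans hU) (by rw [Finset.card_erase_of_mem hm]; omega)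
        (fun y hy => by
          rw [Finset.mem_erase] at hy
          exact lt_of_le_of_ne (Finset.min'_le _ _ hy.2) (Ne.symm hy.1))
      rwa [Finset.insert_erase hm] at this
    have hsum := Finset.card_filter_add_card_filter_not (s := T) φ
    rw [hTc] at hsum
    by_cases h : n ≤ (T.filter φ).card
    · obtain ⟨T', hT', hc⟩ := Finset.exists_subset_card_eq h
      refine ⟨T', fun y hy => hT (Finset.mem_filter.1 (hT' hy)).1, hc, True, fun U hU hUc => ?_⟩
      obtain ⟨x, hx, hxc⟩ := key U (fun y hy => (Finset.mem_filter.1 (hT' (hU hy))).1) hUc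
      have := (Finset.mem_filter.1 (hT' (hU hx))).2
      tauto
    · have h : n ≤ (T.filter (fun x => ¬ φ x)).card := by omega
      obtain ⟨T', hT', hc⟩ := Finset.exists_subset_card_eq h
      refine ⟨T', fun y hy => hT (Finset.mem_filter.1 (hT' hy)).1, hc, False, fun U hU hUc => ?_⟩
      obtain ⟨x, hx, hxc⟩ := key U (fun y hy => (Finset.mem_filter.1 (hT' (hU hy))).1) hUc
      have := (Finset.mem_filter.1 (hT' (hU hx))).2
      tauto

/-- simultaneous Ramsey for all uniformities `< k`. -/
lemma ramsey_all (k : ℕ) : ∀ n : ℕ, ∃ K : ℕ, ∀ (c : ℕ → Finset ℕ → Prop) (S : Finset ℕ), K ≤ S.card →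
      ∃ T ⊆ S, T.card = n ∧ ∀ i < k, ∃ P : Prop, ∀ U ⊆ T, U.card = i → (c i U ↔ P) := by
  induction k with
  | zero =>
    intro n
    refine ⟨n, fun c S hS => ?_⟩
    obtain ⟨T, hT, hc⟩ := Finset.exists_subset_card_eq hS
    exact ⟨T, hT, hc, by simp⟩
  | succ k ih =>
    intro n
    obtain ⟨K, hK⟩ := ramsey k n
    obtain ⟨K', hK'⟩ := ih K
    refine ⟨K', fun c S hS => ?_⟩
    obtain ⟨T, hT, hTc, h⟩ := hK' c S hS
    obtain ⟨T', hT', hTc', h'⟩ := hK (c k) T hTc.ge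
    refine ⟨T', hT'.trans hT, hTc', fun i hi => ?_⟩
    rcases Nat.lt_succ_iff_lt_or_eq.1 hi with h1 | rfl
    · obtain ⟨P, hP⟩ := h i h1
      exact ⟨P, fun U hU => hP U (hU.trans hT')⟩
    · exact h'

/-- `i` is the top differing bit of `x < y`. -/
def IsTop (x y i : ℕ) : Prop :=
  x.testBit i = false ∧ y.testBit i = true ∧ ∀ j, i < j → x.testBit j = y.testBit j

def dl (x y : ℕ) : ℕ := if h : ∃ i, IsTop x y i then h.choose else 0

lemma isTop_unique {x y i j : ℕ} (hi : IsTop x y i) (hj : IsTop x y j) : i = j := by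
  obtain ⟨a, b, c⟩ := hi
  obtain ⟨a', b', c'⟩ := hj
  rcases lt_trichotomy i j with h | h | h
  · have := c j h; rw [a', b'] at this; cases this
  · exact h
  · have := c' i h; rw [a, b] at this; cases this

lemma dl_eq {x y i : ℕ} (hi : IsTop x y i) : dl x y = i := by
  have h : ∃ i, IsTop x y i := ⟨i, hi⟩
  rw [dl, dif_pos h]
  exact isTop_unique h.choose_spec hi

lemma exists_isTop {x y : ℕ} (h : x < y) : ∃ i, IsTop x y i := by
  have hne : x ^^^ y ≠ 0 := by
    intro h0
    exact h.ne (Nat.xor_eq_zero_iff.1 h0)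
  obtain ⟨i, hi, hi'⟩ := Nat.exists_most_significant_bit hne
  have hj : ∀ j, i < j → x.testBit j = y.testBit j := by
    intro j hj
    have := hi' j hj
    rw [Nat.testBit_xor] at this
    simpa using this
  rw [Nat.testBit_xor] at hi
  cases hx : x.testBit i with
  | false =>
    refine ⟨i, hx, ?_, hj⟩
    rw [hx] at hi; simpa using hi
  | true =>
    have hy : y.testBit i = false := by rw [hx] at hi; simpa using hi
    exact absurd (Nat.lt_of_testBit i hy hx (fun j h => (hj j h).symm)) (by omega)

lemma dl_isTop {x y : ℕ} (h : x < y) : IsTop x y (dl x y) := by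
  obtain ⟨i, hi⟩ := exists_isTop h
  rw [dl_eq hi]; exact hi

lemma dl_lt {x y N : ℕ} (h : x < y) (hy : y < 2 ^ N) : dl x y < N := by
  by_contra hN
  have h1 := (dl_isTop h).2.1
  have : y < 2 ^ dl x y := hy.trans_le (Nat.pow_le_pow_right (by norm_num) (by omega))
  rw [Nat.testBit_lt_two_pow this] at h1
  cases h1

lemma dl_ne {x y z : ℕ} (h : x < y) (h' : y < z) : dl x y ≠ dl y z := by
  intro e
  have h1 := (dl_isTop h).2.1
  have h2 := (dl_isTop h').1
  rw [e, h2] at h1; cases h1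

lemma dl_max {x y z : ℕ} (h : x < y) (h' : y < z) : dl x z = max (dl x y) (dl y z) := by
  obtain ⟨a, b, c⟩ := dl_isTop h
  obtain ⟨a', b', c'⟩ := dl_isTop h'
  rcases lt_or_gt_of_ne (dl_ne h h') with e | e
  · rw [max_eq_right e.le]
    exact dl_eq ⟨by rw [c _ e]; exact a', b', fun j hj => (c j (e.trans hj)).trans (c' j hj)⟩
  · rw [max_eq_left e.le]
    exact dl_eq ⟨a, by rw [← c' _ e]; exact b, fun j hj => (c j hj).trans (c' j (e.trans hj))⟩


open Filter Topology

lemma D_cont (k : ℕ) : Continuous (D k) := by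
  unfold D
  refine Continuous.matrix_det ?_
  refine continuous_pi fun i => continuous_pi fun j => ?_
  simp only [Matrix.of_apply]
  fun_prop

lemma D_diff (k : ℕ) (v : Fin (k+2) → ℕ → ℝ) (hv : ∀ j, v j 0 = 1) :
    D (k+1) v = D k (fun j r => v j.succ (r+1) - v j.castSucc (r+1)) := by
  unfold D
  rw [Matrix.det_eq_of_forall_col_eq_smul_add_pred (n := k+1)
    (B := Matrix.of fun (i : Fin (k+2)) (j : Fin (k+2)) =>
      (Fin.cases (v 0 i) (fun j' : Fin (k+1) => v j'.succ i - v j'.castSucc i) j : ℝ)) (fun _ => 1)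
    (by intro i; simp) (by intro i j; simp)]
  rw [Matrix.det_succ_row_zero, Fin.sum_univ_succ, Finset.sum_eq_zero]
  · simp [hv]
    congr 1
  · intro i _
    simp [hv]

lemma D_scale (k : ℕ) (v : Fin (k+1) → ℕ → ℝ) (c : Fin (k+1) → ℝ) :
    D k (fun j r => c j * v j r) = (∏ j, c j) * D k v := by
  unfold D
  rw [← Matrix.det_mul_row]
  rfl

def q (u : ℕ → ℕ → ℝ) (N : ℕ) (M : ℝ) (x : ℕ) : ℕ → ℝ
  | 0 => 1
  | (r+1) => ∑ i ∈ Finset.range N, (if x.testBit i then M^i else 0) * u i r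

lemma q_lim (u : ℕ → ℕ → ℝ) (N x y r : ℕ) (h : x < y) (hy : y < 2^N) :
    Tendsto (fun M : ℝ => (M ^ dl x y)⁻¹ * (q u N M y (r+1) - q u N M x (r+1))) atTop
      (𝓝 (u (dl x y) r)) := by
  obtain ⟨a, b, c⟩ := dl_isTop h
  have hlt := dl_lt h hy
  set e := dl x y
  have h1 : ∀ M : ℝ, (M ^ e)⁻¹ * (q u N M y (r+1) - q u N M x (r+1)) =
      ∑ i ∈ Finset.range N, (M ^ e)⁻¹ * (((if y.testBit i then M^i else 0) -
        (if x.testBit i then M^i else 0)) * u i r) := by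
    intro M
    simp only [q]
    rw [← Finset.sum_sub_distrib, Finset.mul_sum]
    refine Finset.sum_congr rfl fun i _ => ?_
    ring
  simp only [h1]
  have h2 : u e r = ∑ i ∈ Finset.range N, if i = e then u i r else 0 := by
    rw [Finset.sum_ite_eq' (Finset.range N) e]; simp [hlt]
  rw [h2]
  refine tendsto_finsetSum _ fun i _ => ?_
  rcases lt_trichotomy i e with hi | hi | hi
  · rw [if_neg hi.ne]
    have h3 := tendsto_pow_div_pow_atTop_zero (𝕜 := ℝ) hi
    have h4 := h3.mul_const (((if y.testBit i then (1:ℝ) else 0) -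
        (if x.testBit i then 1 else 0)) * u i r)
    rw [zero_mul] at h4
    refine h4.congr fun M => ?_
    split_ifs <;> ring
  · subst hi
    rw [if_pos rfl, a, b]
    refine Tendsto.congr' ?_ tendsto_const_nhds
    filter_upwards [eventually_gt_atTop 0] with M hM
    have : M ^ e ≠ 0 := (pow_pos hM _).ne'
    simp
    field_simp
  · rw [if_neg hi.ne', c i hi]
    simp

lemma q_sign (u : ℕ → ℕ → ℝ) (N k : ℕ) (x : Fin (k+2) → ℕ) (hx : StrictMono x)
    (hN : ∀ i, x i < 2^N)
    (hD : D k (fun j => u (dl (x j.castSucc) (x j.succ))) ≠ 0) :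
    ∀ᶠ M : ℝ in atTop, 0 < D (k+1) (fun i => q u N M (x i)) *
      D k (fun j => u (dl (x j.castSucc) (x j.succ))) := by
  set L := D k (fun j => u (dl (x j.castSucc) (x j.succ))) with hL
  have ht : Tendsto (fun M : ℝ => D k (fun j r => (M ^ dl (x j.castSucc) (x j.succ))⁻¹ *
      (q u N M (x j.succ) (r+1) - q u N M (x j.castSucc) (r+1)))) atTop (𝓝 L) := by
    refine ((D_cont k).tendsto _).comp ?_
    rw [tendsto_pi_nhds]; intro j
    rw [tendsto_pi_nhds]; intro r
    exact q_lim u N _ _ r (hx (Fin.castSucc_lt_succ)) (hN _)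
  have ht2 := ht.mul_const L
  have hpos : 0 < L * L := mul_self_pos.2 hD
  filter_upwards [ht2.eventually (lt_mem_nhds hpos), eventually_gt_atTop 0] with M hM hM0
  rw [D_scale] at hM
  rw [D_diff _ _ (fun j => rfl)]
  rw [mul_assoc] at hM
  exact (mul_pos_iff_of_pos_left (Finset.prod_pos fun j _ => inv_pos.2 (pow_pos hM0 _))).1 hM

lemma perturb_ne (k : ℕ) (v : Fin (k+1) → ℕ → ℝ) (x : Fin (k+1) → ℕ) (hx : Function.Injective x) :
    ∀ᶠ t : ℝ in 𝓝[>] 0, D k (fun i r => (1 - t) * v i r + t * (x i : ℝ)^r) ≠ 0 := by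
  let P : Polynomial ℝ := Matrix.det (Matrix.of fun i j : Fin (k+1) =>
    (1 - Polynomial.X) * Polynomial.C (v j i) + Polynomial.X * Polynomial.C ((x j : ℝ)^(i:ℕ)))
  have hP : ∀ t : ℝ, P.eval t = D k (fun i r => (1 - t) * v i r + t * (x i : ℝ)^r) := by
    intro t
    have := RingHom.map_det (Polynomial.evalRingHom t) (Matrix.of fun i j : Fin (k+1) =>
    (1 - Polynomial.X) * Polynomial.C (v j i) + Polynomial.X * Polynomial.C ((x j : ℝ)^(i:ℕ)))
    simp only [Polynomial.coe_evalRingHom] at this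
    rw [this]
    unfold D
    congr 1
    ext i j
    simp [RingHom.mapMatrix_apply]
  have h1 : P.eval 1 ≠ 0 := by
    rw [hP]
    unfold D
    have : (Matrix.of fun i j : Fin (k+1) => ((1 - (1:ℝ)) * v j i + 1 * (x j : ℝ)^(i:ℕ))) =
      (Matrix.vandermonde fun j => (x j : ℝ)).transpose := by
      ext i j; simp [Matrix.vandermonde]
    rw [this, Matrix.det_transpose, Matrix.det_vandermonde_ne_zero_iff]
    intro a b hab
    have hab' : (x a : ℝ) = x b := hab
    exact hx (by exact_mod_cast hab')
  have hP0 : P ≠ 0 := by rintro h; rw [h] at h1; simp at h1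
  have hfin : (P.rootSet ℝ).Finite := P.rootSet_finite ℝ
  have hev : ∀ᶠ t : ℝ in 𝓝[≠] 0, t ∉ P.rootSet ℝ := by
    have hm : (P.rootSet ℝ \ {0})ᶜ ∈ 𝓝 (0:ℝ) :=
      (hfin.subset Set.sdiff_subset).isClosed.isOpen_compl.mem_nhds (by simp)
    filter_upwards [mem_nhdsWithin_of_mem_nhds hm, self_mem_nhdsWithin] with t ht ht0 hr
    exact ht ⟨hr, ht0⟩
  have hev' := hev.filter_mono (nhdsWithin_mono (0:ℝ) (fun t (ht : 0 < t) => (ne_of_gt ht : t ≠ 0)))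
  filter_upwards [hev'] with t ht h0
  apply ht
  rw [Polynomial.mem_rootSet]
  refine ⟨hP0, ?_⟩
  rw [Polynomial.coe_aeval_eq_eval, hP]; exact h0

lemma construct (u : ℕ → ℕ → ℝ) (N d : ℕ) :
    ∃ w : ℕ → ℕ → ℝ, (∀ x, w x 0 = 1) ∧
      ∀ k ≤ d, ∀ x : Fin (k+2) → ℕ, StrictMono x → (∀ i, x i < 2^N) →
        D (k+1) (fun i => w (x i)) ≠ 0 ∧
        (D k (fun j => u (dl (x j.castSucc) (x j.succ))) ≠ 0 →
          0 < D (k+1) (fun i => w (x i)) * D k (fun j => u (dl (x j.castSucc) (x j.succ)))) := by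
  have h1 : ∀ᶠ M : ℝ in atTop, ∀ k : Fin (d+1), ∀ x : Fin (k+2) → Fin (2^N), StrictMono x →
      D k (fun j => u (dl (x j.castSucc) (x j.succ))) ≠ 0 →
      0 < D (k+1) (fun i => q u N M (x i)) *
        D k (fun j => u (dl (x j.castSucc) (x j.succ))) := by
    refine eventually_all.2 fun k => eventually_all.2 fun x => ?_
    by_cases hx : StrictMono x
    · by_cases hD : D k (fun j => u (dl (x j.castSucc) (x j.succ))) ≠ 0
      · filter_upwards [q_sign u N k (fun i => (x i : ℕ)) (fun a b h => hx h) (fun i => (x i).2) hD]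
          with M hM _ _ using hM
      · exact Eventually.of_forall fun M _ h => absurd h hD
    · exact Eventually.of_forall fun M h => absurd h hx
  obtain ⟨M, hM⟩ := h1.exists
  have h2 : ∀ᶠ t : ℝ in 𝓝[>] 0, ∀ k : Fin (d+1), ∀ x : Fin (k+2) → Fin (2^N), StrictMono x →
      D (k+1) (fun i r => (1 - t) * q u N M (x i) r + t * ((x i : ℕ) : ℝ)^r) ≠ 0 ∧
      (D k (fun j => u (dl (x j.castSucc) (x j.succ))) ≠ 0 →
      0 < D (k+1) (fun i r => (1 - t) * q u N M (x i) r + t * ((x i : ℕ) : ℝ)^r) *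
        D k (fun j => u (dl (x j.castSucc) (x j.succ)))) := by
    refine eventually_all.2 fun k => eventually_all.2 fun x => ?_
    by_cases hx : StrictMono x
    · have e1 := perturb_ne (k+1) (fun i => q u N M (x i)) (fun i => (x i : ℕ))
        (fun a b h => hx.injective (Fin.ext h))
      by_cases hD : D k (fun j => u (dl (x j.castSucc) (x j.succ))) ≠ 0
      · have hp := hM k x hx hD
        have hc : Continuous (fun t : ℝ =>
          D (k+1) (fun i r => (1 - t) * q u N M (x i) r + t * ((x i : ℕ) : ℝ)^r) *
            D k (fun j => u (dl (x j.castSucc) (x j.succ)))) := by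
          refine Continuous.mul ((D_cont _).comp ?_) continuous_const
          refine continuous_pi fun i => continuous_pi fun r => ?_
          fun_prop
        have ht := hc.tendsto 0
        simp only [sub_zero, one_mul, zero_mul, add_zero] at ht
        have e2 := (ht.eventually (lt_mem_nhds hp)).filter_mono (nhdsWithin_le_nhds (s := Set.Ioi 0))
        filter_upwards [e1, e2] with t h1 h2 _ using ⟨h1, fun _ => h2⟩
      · filter_upwards [e1] with t h1 _ using ⟨h1, fun h => absurd h hD⟩
    · exact Eventually.of_forall fun M h => absurd h hx
  obtain ⟨t, ht⟩ := h2.exists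
  refine ⟨fun x r => (1 - t) * q u N M x r + t * (x : ℝ)^r, fun x => by simp [q], ?_⟩
  intro k hk x hx hN
  exact ht ⟨k, by omega⟩ (fun i => ⟨x i, hN i⟩) (fun a b h => hx h)



lemma sm_cons {k : ℕ} (a : ℕ) (t : Fin k → ℕ) (ht : StrictMono t) (h : ∀ i, a < t i) :
    StrictMono (Fin.cons a t : Fin (k+1) → ℕ) := by
  intro i j hij
  induction i using Fin.cases with
  | zero =>
    induction j using Fin.cases with
    | zero => exact absurd hij (lt_irrefl _)
    | succ j => simpa using h j
  | succ i =>
    induction j using Fin.cases with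
    | zero => exact absurd hij (by simp)
    | succ j => simpa using ht (Fin.succ_lt_succ_iff.1 hij)

lemma sm_snoc {k : ℕ} (a : ℕ) (t : Fin k → ℕ) (ht : StrictMono t) (h : ∀ i, t i < a) :
    StrictMono (Fin.snoc t a : Fin (k+1) → ℕ) := by
  intro i j hij
  induction j using Fin.lastCases with
  | last =>
    induction i using Fin.lastCases with
    | last => exact absurd hij (lt_irrefl _)
    | cast i => simpa using h i
  | cast j =>
    induction i using Fin.lastCases with
    | last => exact absurd hij (by simp [Fin.le_last])
    | cast i => simpa using ht (Fin.castSucc_lt_castSucc_iff.1 hij)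

lemma descent (d : ℕ) (v : ℕ → ℕ → ℝ) (s : ℕ → ℝ)
    (hT : ∀ k, 1 ≤ k → k ≤ d → ∀ t : Fin (k+1) → ℕ, StrictMono t → (∀ i, t i < 2*d+3) →
      (∀ i, t i ≠ d+1) → 0 < s k * D k (fun i => v (t i)))
    (hTop : ∀ t : Fin (d+2) → ℕ, StrictMono t → (∀ i, t i < 2*d+3) →
      0 < s (d+1) * D (d+1) (fun i => v (t i))) :
    ∀ e k, 1 ≤ k → k + e = d+1 → ∀ t : Fin (k+1) → ℕ, StrictMono t →
      (∀ i, e ≤ t i ∧ t i < 2*d+3-e) → 0 < s k * D k (fun i => v (t i)) := by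
  intro e
  induction e with
  | zero =>
    intro k hk hke t ht hr
    obtain rfl : k = d+1 := by omega
    exact hTop t ht (fun i => (hr i).2)
  | succ e ih =>
    intro k hk hke t ht hr
    by_cases hav : ∀ i, t i ≠ d+1
    · exact hT k hk (by omega) t ht (fun i => by have := hr i; omega) hav
    push Not at hav
    obtain ⟨r, hrr⟩ := hav
    let τ : Fin (k+3) → ℕ := Fin.cons (t 0 - 1) (Fin.snoc t (t (Fin.last k) + 1))
    have h0 : τ 0 = t 0 - 1 := rfl
    have hm : ∀ i : Fin (k+1), τ i.castSucc.succ = t i := by intro i; simp [τ]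
    have hl : τ (Fin.last (k+2)) = t (Fin.last k) + 1 := by
      rw [← Fin.succ_last]; simp [τ]
    have hlow : ∀ i, t 0 ≤ t i := fun i => ht.monotone (Fin.zero_le i)
    have hup : ∀ i, t i ≤ t (Fin.last k) := fun i => ht.monotone (Fin.le_last i)
    have hr0 := hr 0
    have hrl := hr (Fin.last k)
    have hτ : StrictMono τ := by
      rw [Fin.strictMono_iff_lt_succ]
      intro i
      refine Fin.cases ?_ (fun i => ?_) i
      · have : (Fin.succ (0 : Fin (k+2))) = (Fin.castSucc (0 : Fin (k+1))).succ := rfl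
        rw [this, hm]
        show t 0 - 1 < t 0
        omega
      · refine Fin.lastCases ?_ (fun j => ?_) i
        · have e1 : (Fin.succ (Fin.last (k+1))) = Fin.last (k+2) := rfl
          have e2 : (Fin.castSucc (Fin.succ (Fin.last k))) = (Fin.castSucc (Fin.last k)).succ := rfl
          have e3 : (Fin.castSucc (Fin.succ (Fin.last k)) : Fin (k+3)) = (Fin.last k).castSucc.succ := rfl
          have := hm (Fin.last k)
          show τ ((Fin.last k).castSucc.succ) < τ (Fin.last (k+2))
          rw [this, hl]; omega
        · show τ (j.castSucc.castSucc.succ) < τ (j.succ.castSucc.succ)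
          rw [hm, hm]; exact ht Fin.castSucc_lt_succ
    have hτr : ∀ i, e ≤ τ i ∧ τ i < 2*d+3-e := by
      intro i
      have a : τ 0 ≤ τ i := hτ.monotone (Fin.zero_le i)
      have b : τ i ≤ τ (Fin.last _) := hτ.monotone (Fin.le_last i)
      omega
    have hA : ∀ j : Fin (k+3), 0 < s (k+1) * D (k+1) (fun i => v (τ (j.succAbove i))) := by
      intro j
      exact ih (k+1) (by omega) (by omega) (fun i => τ (j.succAbove i))
        (hτ.comp (Fin.strictMono_succAbove j)) (fun i => hτr _)
    have hP := plucker k (fun i => v (τ i)) r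
    have hne : ∀ i : Fin k, t (r.succAbove i) ≠ d+1 := by
      intro i h
      rw [← hrr] at h
      exact Fin.succAbove_ne r i (ht.injective h)
    have hts : StrictMono (fun i => t (r.succAbove i)) := ht.comp (Fin.strictMono_succAbove r)
    have hr1 := hlow r
    have hr2 := hup r
    have hB : 0 < s k * D k (Fin.cons (v (τ 0)) (fun i => v (τ (r.succAbove i).castSucc.succ))) := by
      have := hT k hk (by omega) (Fin.cons (t 0 - 1) (fun i => t (r.succAbove i)))
        (sm_cons _ _ hts (fun i => by have := hlow (r.succAbove i); omega))
        (fun i => by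
          induction i using Fin.cases with
          | zero => simp only [Fin.cons_zero]; omega
          | succ i => simp only [Fin.cons_succ]; have := hr (r.succAbove i); omega)
        (fun i => by
          induction i using Fin.cases with
          | zero => simp only [Fin.cons_zero]; omega
          | succ i => simp only [Fin.cons_succ]; exact hne i)
      convert this using 3
      funext i
      induction i using Fin.cases with
      | zero => simp [h0]
      | succ i => simp only [Fin.cons_succ, hm]
    have hC : 0 < s k * D k (Fin.snoc (fun i => v (τ (r.succAbove i).castSucc.succ))
        (v (τ (Fin.last _)))) := by
      have := hT k hk (by omega) (Fin.snoc (fun i => t (r.succAbove i)) (t (Fin.last k) + 1))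
        (sm_snoc _ _ hts (fun i => by have := hup (r.succAbove i); omega))
        (fun i => by
          induction i using Fin.lastCases with
          | last => simp only [Fin.snoc_last]; omega
          | cast i => simp only [Fin.snoc_castSucc]; have := hr (r.succAbove i); omega)
        (fun i => by
          induction i using Fin.lastCases with
          | last => simp only [Fin.snoc_last]; omega
          | cast i => simp only [Fin.snoc_castSucc]; exact hne i)
      convert this using 3
      funext i
      induction i using Fin.lastCases with
      | last => simp only [Fin.snoc_last, hl]
      | cast i => simp only [Fin.snoc_castSucc, hm]
    simp only [hm] at hP
    have a1 := hA r.castSucc.succ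
    have a2 := hA 0
    have a3 := hA (Fin.last _)
    simp only [hm] at hB hC
    set x := D k (fun i => v (t i))
    have key : 0 < (s k * x) * (s (k+1) * D (k+1) (fun i => v (τ (r.castSucc.succ.succAbove i)))) := by
      have e : (s k * x) * (s (k+1) * D (k+1) (fun i => v (τ (r.castSucc.succ.succAbove i)))) =
        s k * s (k+1) * (x * D (k+1) (fun i => v (τ (r.castSucc.succ.succAbove i)))) := by ring
      rw [e, hP]
      have := add_pos (mul_pos hB a2) (mul_pos hC a3)
      refine this.trans_eq ?_
      ring
    exact (mul_pos_iff_of_pos_right a1).1 key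

lemma block (δ : ℕ → ℕ) (o n : ℕ) (h : ∀ i, o ≤ i → i + 1 < o + 2*n+1 → δ i ≠ δ (i+1)) :
    (∃ i, o ≤ i ∧ i + 2 < o + 2*n+1 ∧ δ (i+1) < δ i ∧ δ (i+1) < δ (i+2)) ∨
    (∀ i, o ≤ i → i + 1 < o + n → δ i < δ (i+1)) ∨
    (∀ i, o + n ≤ i → i + 1 < o + n + n → δ (i+1) < δ i) := by
  by_contra hc
  push Not at hc
  obtain ⟨h1, ⟨i, hi, hi2, hi3⟩, ⟨j, hj, hj2, hj3⟩⟩ := hc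
  have key : ∀ l, i + l + 1 < o + 2*n+1 → δ (i+l+1) < δ (i+l) := by
    intro l
    induction l with
    | zero => intro hl; have := h i hi (by omega); simp only [add_zero]; omega
    | succ l ih =>
      intro hl
      have a := ih (by omega)
      have b := h1 (i+l) (by omega) (by omega) a
      have c := h (i+l+1) (by omega) (by omega)
      have e1 : i + (l+1) = i+l+1 := by ring
      have e2 : i + l + 1 + 1 = i+l+2 := by ring
      rw [e1, e2]
      rw [e2] at c
      omega
  have := key (j - i) (by omega)
  rw [show i + (j-i) = j by omega] at this
  omega

lemma dl_inc (g : ℕ → ℕ) (m a : ℕ) (hg : ∀ i j, i < j → j < m → g i < g j) : ∀ l, a + l + 1 < m →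
    (∀ i, a ≤ i → i < a + l → dl (g i) (g (i+1)) < dl (g (i+1)) (g (i+2))) →
    dl (g a) (g (a+l+1)) = dl (g (a+l)) (g (a+l+1)) := by
  intro l
  induction l with
  | zero => intros; rfl
  | succ l ih =>
    intro hm h
    have := ih (by omega) (fun i h1 h2 => h i h1 (by omega))
    have h3 := h (a+l) (by omega) (by omega)
    show dl (g a) (g (a+l+1+1)) = dl (g (a+l+1)) (g (a+l+1+1))
    rw [dl_max (hg a (a+l+1) (by omega) (by omega)) (hg (a+l+1) (a+l+1+1) (by omega) (by omega)), this]
    exact max_eq_right h3.le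

lemma dl_dec (g : ℕ → ℕ) (m a : ℕ) (hg : ∀ i j, i < j → j < m → g i < g j) : ∀ l, a + l + 1 < m →
    (∀ i, a ≤ i → i < a + l → dl (g (i+1)) (g (i+2)) < dl (g i) (g (i+1))) →
    dl (g a) (g (a+l+1)) = dl (g a) (g (a+1)) ∧ dl (g (a+l)) (g (a+l+1)) ≤ dl (g a) (g (a+1)) := by
  intro l
  induction l with
  | zero => intros; exact ⟨rfl, le_rfl⟩
  | succ l ih =>
    intro hm h
    have ⟨h1, h2⟩ := ih (by omega) (fun i h1 h2 => h i h1 (by omega))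
    have h3 := h (a+l) (by omega) (by omega)
    show dl (g a) (g (a+l+1+1)) = _ ∧ dl (g (a+l+1)) (g (a+l+1+1)) ≤ _
    have h4 : dl (g (a+l+1)) (g (a+l+1+1)) ≤ dl (g a) (g (a+1)) := h3.le.trans h2
    rw [dl_max (hg a (a+l+1) (by omega) (by omega)) (hg (a+l+1) (a+l+1+1) (by omega) (by omega)), h1]
    exact ⟨max_eq_left h4, h4⟩

def NoHom (u : ℕ → ℕ → ℝ) (d N m : ℕ) : Prop := ∀ (s : ℝ) (g : ℕ → ℕ),
  (∀ i j, i < j → j < m → g i < g j) → (∀ i < m, g i < N) →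
  (∀ t : Fin (d+1) → ℕ, StrictMono t → (∀ i, t i < m) → 0 < s * D d (fun i => u (g (t i)))) → False

structure Good (d N m : ℕ) (u : ℕ → ℕ → ℝ) : Prop where
  one : ∀ x, u x 0 = 1
  gp : ∀ k, 1 ≤ k → k ≤ d → ∀ t : Fin (k+1) → ℕ, StrictMono t → (∀ i, t i < N) →
    D k (fun i => u (t i)) ≠ 0
  pos : ∀ x y, x < y → y < N → 0 < D 1 (fun i => u (![x, y] i))
  nohom : NoHom u d N m

def Lift (u w : ℕ → ℕ → ℝ) (N d : ℕ) : Prop := ∀ k ≤ d, ∀ x : Fin (k+2) → ℕ, StrictMono x →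
  (∀ i, x i < 2^N) → D (k+1) (fun i => w (x i)) ≠ 0 ∧
        (D k (fun j => u (dl (x j.castSucc) (x j.succ))) ≠ 0 →
          0 < D (k+1) (fun i => w (x i)) * D k (fun j => u (dl (x j.castSucc) (x j.succ))))

lemma sgn {s a b : ℝ} (h1 : 0 < s * a) (h2 : 0 < a * b) : 0 < s * b := by
  have h := mul_pos h1 h2
  have ha : a ≠ 0 := by rintro rfl; simp at h1
  have h3 : 0 < a * a := mul_self_pos.2 ha
  have : (s * a) * (a * b) = (a*a) * (s * b) := by ring
  rw [this] at h
  exact (mul_pos_iff_of_pos_left h3).1 h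

lemma run_inc {d N m n o : ℕ} {u w : ℕ → ℕ → ℝ} (hd : 1 ≤ d) (hu : Good d N n u)
    (hL : Lift u w N d) (s : ℝ) (g : ℕ → ℕ)
    (hg : ∀ i j, i < j → j < m → g i < g j) (hgN : ∀ i < m, g i < 2^N)
    (hh : ∀ t : Fin (d+2) → ℕ, StrictMono t → (∀ i, t i < m) →
      0 < s * D (d+1) (fun i => w (g (t i)))) (hom : o + n < m)
    (hi : ∀ i, o ≤ i → i + 1 < o + n → dl (g i) (g (i+1)) < dl (g (i+1)) (g (i+2))) : False := by
  have hmono : ∀ i j, i < j → j < n →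
      dl (g (o+i)) (g (o+i+1)) < dl (g (o+j)) (g (o+j+1)) := by
    intro i j hij hj
    induction j, hij using Nat.le_induction with
    | base => exact hi (o+i) (by omega) (by omega)
    | succ j hij ih => exact (ih (by omega)).trans (hi (o+j) (by omega) (by omega))
  refine hu.nohom s (fun i => dl (g (o+i)) (g (o+i+1))) hmono
    (fun i hi => dl_lt (hg _ _ (by omega) (by omega)) (hgN _ (by omega))) ?_
  intro t ht htn
  let y : Fin (d+2) → ℕ := Fin.cons (o + t 0) (fun i => o + t i + 1)
  have hy : StrictMono y := by
    refine sm_cons _ _ (fun a b hab => ?_) (fun i => ?_)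
    · have := ht hab; omega
    · have : t 0 ≤ t i := ht.monotone (Fin.zero_le i)
      omega
  have hym : ∀ i, y i < m := by
    intro i
    induction i using Fin.cases with
    | zero => have := htn 0; simp only [y, Fin.cons_zero]; omega
    | succ i => have := htn i; simp only [y, Fin.cons_succ]; omega
  have hdl : ∀ j : Fin (d+1), dl (g (y j.castSucc)) (g (y j.succ)) =
      dl (g (o + t j)) (g (o + t j + 1)) := by
    intro j
    induction j using Fin.cases with
    | zero => rfl
    | succ j =>
      have h1 : t j.castSucc < t j.succ := ht Fin.castSucc_lt_succ
      have h2 := htn j.succ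
      have := dl_inc g m (o + t j.castSucc + 1) hg (t j.succ - t j.castSucc - 1) (by omega)
        (fun i a b => hi i (by omega) (by omega))
      rw [show o + t j.castSucc + 1 + (t j.succ - t j.castSucc - 1) = o + t j.succ by omega] at this
      exact this
  have h1 := hh y hy hym
  have h2 := (hL d le_rfl (fun i => g (y i)) (fun a b hab => hg _ _ (hy hab) (hym b))
    (fun i => hgN _ (hym i))).2
  simp only [hdl] at h2
  refine sgn h1 (h2 ?_)
  exact hu.gp d hd le_rfl _ (fun a b hab => hmono _ _ (ht hab) (htn b))
    (fun i => by
      have := htn i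
      exact dl_lt (hg _ _ (by omega) (by omega)) (hgN _ (by omega)))

lemma D_rev (k : ℕ) (v : Fin (k+1) → ℕ → ℝ) :
    D k (fun i => v i.rev) = ((Equiv.Perm.sign (Fin.revPerm : Equiv.Perm (Fin (k+1))) : ℤ) : ℝ) * D k v := by
  unfold D
  rw [← Matrix.det_permute']
  rfl

lemma run_dec {d N m n o : ℕ} {u w : ℕ → ℕ → ℝ} (hd : 1 ≤ d) (hu : Good d N n u)
    (hL : Lift u w N d) (s : ℝ) (g : ℕ → ℕ)
    (hg : ∀ i j, i < j → j < m → g i < g j) (hgN : ∀ i < m, g i < 2^N)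
    (hh : ∀ t : Fin (d+2) → ℕ, StrictMono t → (∀ i, t i < m) →
      0 < s * D (d+1) (fun i => w (g (t i)))) (hom : o + n < m)
    (hi : ∀ i, o ≤ i → i + 1 < o + n → dl (g (i+1)) (g (i+2)) < dl (g i) (g (i+1))) : False := by
  have hmono : ∀ i j, i < j → j < n →
      dl (g (o+j)) (g (o+j+1)) < dl (g (o+i)) (g (o+i+1)) := by
    intro i j hij hj
    induction j, hij using Nat.le_induction with
    | base => exact hi (o+i) (by omega) (by omega)
    | succ j hij ih => exact (hi (o+j) (by omega) (by omega)).trans (ih (by omega))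
  have hmono' : ∀ i j, i < j → j < n →
      dl (g (o+(n-1-i))) (g (o+(n-1-i)+1)) < dl (g (o+(n-1-j))) (g (o+(n-1-j)+1)) := by
    intro i j hij hj
    exact hmono _ _ (by omega) (by omega)
  refine hu.nohom (s * ((Equiv.Perm.sign (Fin.revPerm : Equiv.Perm (Fin (d+1))) : ℤ) : ℝ))
    (fun i => dl (g (o+(n-1-i))) (g (o+(n-1-i)+1))) hmono'
    (fun i hi => dl_lt (hg _ _ (by omega) (by omega)) (hgN _ (by omega))) ?_
  intro t' ht' htn'
  rw [mul_assoc, ← D_rev d (fun i => u (dl (g (o+(n-1-t' i))) (g (o+(n-1-t' i)+1))))]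
  obtain ⟨t, ht_def⟩ : ∃ t : Fin (d+1) → ℕ, t = fun i => n - 1 - t' i.rev := ⟨_, rfl⟩
  have ht : StrictMono t := by
    intro a b hab
    have := ht' (Fin.rev_lt_rev.2 hab)
    have := htn' a.rev
    simp only [ht_def]; omega
  have htn : ∀ i, t i < n := by
    intro i
    have := htn' i.rev
    simp only [ht_def]; omega
  let y : Fin (d+2) → ℕ := Fin.snoc (fun i => o + t i) (o + t (Fin.last d) + 1)
  have hy : StrictMono y := by
    refine sm_snoc _ _ (fun a b hab => ?_) (fun i => ?_)
    · have := ht hab; omega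
    · have : t i ≤ t (Fin.last d) := ht.monotone (Fin.le_last i)
      omega
  have hym : ∀ i, y i < m := by
    intro i
    induction i using Fin.lastCases with
    | last => have := htn (Fin.last d); simp only [y, Fin.snoc_last]; omega
    | cast i => have := htn i; simp only [y, Fin.snoc_castSucc]; omega
  have hdl : ∀ j : Fin (d+1), dl (g (y j.castSucc)) (g (y j.succ)) =
      dl (g (o + t j)) (g (o + t j + 1)) := by
    intro j
    induction j using Fin.lastCases with
    | last => simp only [y, Fin.snoc_castSucc, Fin.succ_last, Fin.snoc_last]
    | cast j =>
      have h1 : t j.castSucc < t j.succ := ht Fin.castSucc_lt_succ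
      have h2 := htn j.succ
      have := (dl_dec g m (o + t j.castSucc) hg (t j.succ - t j.castSucc - 1) (by omega)
        (fun i a b => hi i (by omega) (by omega))).1
      rw [show o + t j.castSucc + (t j.succ - t j.castSucc - 1) + 1 = o + t j.succ by omega] at this
      rw [← this, ← Fin.castSucc_succ]
      simp only [y, Fin.snoc_castSucc]
  have h1 := hh y hy hym
  have h2 := (hL d le_rfl (fun i => g (y i)) (fun a b hab => hg _ _ (hy hab) (hym b))
    (fun i => hgN _ (hym i))).2
  simp only [hdl] at h2
  have he : (fun i : Fin (d+1) => u (dl (g (o + t i)) (g (o + t i + 1)))) =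
    fun i => u (dl (g (o+(n-1-t' i.rev))) (g (o+(n-1-t' i.rev)+1))) := by rw [ht_def]
  rw [he] at h2
  refine sgn h1 (h2 ?_)
  rw [D_rev d (fun i => u (dl (g (o+(n-1-t' i))) (g (o+(n-1-t' i)+1))))]
  refine mul_ne_zero ?_ ?_
  · have := (Equiv.Perm.sign (Fin.revPerm : Equiv.Perm (Fin (d+1)))).ne_zero
    exact_mod_cast this
  exact hu.gp d hd le_rfl _ (fun a b hab => hmono' _ _ (ht' hab) (htn' b))
    (fun i => by
      have := htn' i
      exact dl_lt (hg _ _ (by omega) (by omega)) (hgN _ (by omega)))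



lemma D1_eq (v : Fin 2 → ℕ → ℝ) : D 1 v = v 0 0 * v 1 1 - v 1 0 * v 0 1 := by
  unfold D
  rw [Matrix.det_fin_two]; simp

lemma D0_eq (v : Fin 1 → ℕ → ℝ) : D 0 v = v 0 0 := by
  unfold D
  simp

lemma sm3 {a b c : ℕ} (h : a < b) (h' : b < c) : StrictMono ![a, b, c] := by
  rw [Fin.strictMono_iff_lt_succ]
  intro i
  fin_cases i
  · exact h
  · exact h'

lemma sm2 {a b : ℕ} (h : a < b) : StrictMono ![a, b] := by
  rw [Fin.strictMono_iff_lt_succ]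
  intro i
  fin_cases i
  exact h

lemma tri_pos {d N m : ℕ} {u w : ℕ → ℕ → ℝ} (hd : 1 ≤ d) (hu : Good d N m u) (hL : Lift u w N d)
    {x y z : ℕ} (h : x < y) (h' : y < z) (hz : z < 2^N) (hlt : dl x y < dl y z) :
    0 < D 2 (fun i => w (![x,y,z] i)) := by
  have hp := hu.pos _ _ hlt (dl_lt h' hz)
  have h1 := (hL 1 hd ![x,y,z] (sm3 h h') (by
    intro i; fin_cases i
    · exact (h.trans h').trans hz
    · exact h'.trans hz
    · exact hz)).2
  have e : D 1 (fun j => u (dl (![x,y,z] j.castSucc) (![x,y,z] j.succ))) =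
      D 1 (fun i => u (![dl x y, dl y z] i)) := by
    rw [D1_eq, D1_eq]; rfl
  have h2 := h1 (by rw [e]; exact hp.ne')
  rw [e] at h2
  exact (mul_pos_iff_of_pos_right hp).1 h2

lemma tri_neg {d N m : ℕ} {u w : ℕ → ℕ → ℝ} (hd : 1 ≤ d) (hu : Good d N m u) (hL : Lift u w N d)
    {x y z : ℕ} (h : x < y) (h' : y < z) (hz : z < 2^N) (hlt : dl y z < dl x y) :
    D 2 (fun i => w (![x,y,z] i)) < 0 := by
  have hp := hu.pos _ _ hlt (dl_lt h (h'.trans hz))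
  have h1 := (hL 1 hd ![x,y,z] (sm3 h h') (by
    intro i; fin_cases i
    · exact (h.trans h').trans hz
    · exact h'.trans hz
    · exact hz)).2
  have e : D 1 (fun j => u (dl (![x,y,z] j.castSucc) (![x,y,z] j.succ))) =
      - D 1 (fun i => u (![dl y z, dl x y] i)) := by
    rw [D1_eq, D1_eq]
    show u (dl x y) 0 * u (dl y z) 1 - u (dl y z) 0 * u (dl x y) 1 =
      -(u (dl y z) 0 * u (dl x y) 1 - u (dl x y) 0 * u (dl y z) 1)
    ring
  have h2 := h1 (by rw [e]; exact (neg_lt_zero.2 hp).ne)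
  rw [e] at h2
  have := neg_pos.1 (show 0 < - D 2 (fun i => w (![x,y,z] i)) from
    (mul_pos_iff_of_pos_right hp).1 (by linarith))
  exact this

lemma core {d N m M : ℕ} {u w : ℕ → ℕ → ℝ} (hd : 1 ≤ d) (hu : Good d N m u) (hL : Lift u w N d)
    (hw : ∀ k, 1 ≤ k → k ≤ d → ∀ x : Fin (k+1) → ℕ, StrictMono x → (∀ i, x i < 2^N) →
      D k (fun i => w (x i)) ≠ 0)
    (s : ℝ) (g : ℕ → ℕ)
    (hg : ∀ i j, i < j → j < M → g i < g j) (hgN : ∀ i < M, g i < 2^N)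
    (hh : ∀ t : Fin (d+2) → ℕ, StrictMono t → (∀ i, t i < M) →
      0 < s * D (d+1) (fun i => w (g (t i))))
    (T : Finset ℕ) (hTc : T.card = 2*d+2)
    (hT1 : ∀ x ∈ T, 1 ≤ x ∧ x + 2 < M ∧ dl (g x) (g (x+1)) < dl (g (x-1)) (g x) ∧
      dl (g x) (g (x+1)) < dl (g (x+1)) (g (x+2)))
    (hT2 : ∀ x ∈ T, ∀ y ∈ T, x < y → x + 1 < y)
    (hT3 : ∀ k < d+1, ∃ P : Prop, ∀ U ⊆ T, ∀ hU : U.card = k+1,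
      (0 < D k (fun a => w (g (U.orderEmbOfFin hU a))) ↔ P)) : False := by
  let τ : ℕ → ℕ := fun i => if h : i < 2*d+2 then T.orderEmbOfFin hTc ⟨i, h⟩ else 0
  have hτT : ∀ i < 2*d+2, τ i ∈ T := by
    intro i hi
    simp only [τ, dif_pos hi]
    exact Finset.orderEmbOfFin_mem _ _ _
  have hτ : ∀ i j, i < j → j < 2*d+2 → τ i < τ j := by
    intro i j hij hj
    simp only [τ, dif_pos hj, dif_pos (hij.trans hj)]
    exact (T.orderEmbOfFin hTc).strictMono hij
  let L : ℕ → ℕ := fun i => if i ≤ d then τ i else if i = d+1 then τ d + 1 else τ (i-1)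
  have hL1 : ∀ i ≤ d, L i = τ i := fun i hi => by simp only [L, if_pos hi]
  have hL2 : L (d+1) = τ d + 1 := by simp [L]
  have hL3 : ∀ i, d+1 < i → L i = τ (i-1) := fun i hi => by
    simp only [L]; rw [if_neg (by omega), if_neg (by omega)]
  have hLm : ∀ i j, i < j → j < 2*d+3 → L i < L j := by
    intro i j hij hj
    have hd1 := hT2 (τ d) (hτT d (by omega))
    rcases lt_trichotomy j (d+1) with h | h | h
    · rw [hL1 i (by omega), hL1 j (by omega)]; exact hτ _ _ hij (by omega)
    · subst h
      rw [hL1 i (by omega), hL2]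
      rcases Nat.lt_or_ge i d with h | h
      · have := hτ i d h (by omega); omega
      · obtain rfl : i = d := by omega
        omega
    · rw [hL3 j h]
      rcases lt_trichotomy i (d+1) with h' | h' | h'
      · rw [hL1 i (by omega)]; exact hτ _ _ (by omega) (by omega)
      · subst h'; rw [hL2]
        exact hd1 _ (hτT (j-1) (by omega)) (hτ _ _ (by omega) (by omega))
      · rw [hL3 i h']; exact hτ _ _ (by omega) (by omega)
  have hLM : ∀ i < 2*d+3, L i < M := by
    intro i hi
    rcases lt_trichotomy i (d+1) with h | h | h
    · rw [hL1 i (by omega)]; have := hT1 _ (hτT i (by omega)); omega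
    · subst h; rw [hL2]; have := hT1 _ (hτT d (by omega)); omega
    · rw [hL3 i h]; have := hT1 _ (hτT (i-1) (by omega)); omega
  choose! P hP using hT3
  let σ : ℕ → ℝ := fun k => if k = d+1 then s else if P k then 1 else -1
  have hdes := descent d (fun i => w (g (L i))) σ ?_ ?_ (d-1) 2 (by omega) (by omega)
  rotate_left
  · intro k hk hkd t ht htr hta
    have hLmono : StrictMono (fun i => L (t i)) := fun a b hab => hLm _ _ (ht hab) (htr b)
    have hmem : ∀ i, L (t i) ∈ T := by
      intro i
      have h1 := htr i
      have h2 := hta i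
      rcases Nat.lt_or_ge (t i) (d+1) with h | h
      · rw [hL1 _ (by omega)]; exact hτT _ (by omega)
      · rw [hL3 _ (by omega)]; exact hτT _ (by omega)
    let U : Finset ℕ := Finset.univ.image (fun i => L (t i))
    have hUc : U.card = k+1 := by
      rw [Finset.card_image_of_injective _ hLmono.injective]; simp
    have hUT : U ⊆ T := by
      intro x hx
      obtain ⟨i, -, rfl⟩ := Finset.mem_image.1 hx
      exact hmem i
    have hUe : (fun i => L (t i)) = U.orderEmbOfFin hUc :=
      Finset.orderEmbOfFin_unique hUc (fun i => Finset.mem_image_of_mem _ (Finset.mem_univ i)) hLmono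
    have hPk := hP k (by omega) U hUT hUc
    rw [← hUe] at hPk
    have hne := hw k hk hkd (fun i => g (L (t i)))
      (fun a b hab => hg _ _ (hLmono hab) (hLM _ (htr b))) (fun i => hgN _ (hLM _ (htr i)))
    have hkd' : k ≠ d+1 := by omega
    simp only [σ, if_neg hkd']
    split_ifs with hp
    · rw [one_mul]; exact hPk.2 hp
    · have h1 := fun h => hp (hPk.1 h)
      have := lt_of_le_of_ne (not_lt.1 h1) hne
      linarith
  · intro t ht htr
    simp only [σ, if_true]
    exact hh (fun i => L (t i)) (fun a b hab => hLm _ _ (ht hab) (htr b)) (fun i => hLM _ (htr i))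
  obtain ⟨q1, q2, q3, q4⟩ := hT1 _ (hτT d (by omega))
  have A := hdes ![d-1, d, d+1] (sm3 (by omega) (by omega)) (by
    intro i; fin_cases i <;> simp <;> omega)
  have B := hdes ![d, d+1, d+2] (sm3 (by omega) (by omega)) (by
    intro i; fin_cases i <;> simp <;> omega)
  have ea : (fun i => w (g (L (![d-1, d, d+1] i)))) = 
      fun i => w (![g (τ (d-1)), g (τ d), g (τ d + 1)] i) := by
    funext i
    fin_cases i
    · simp [hL1]
    · simp [hL1]
    · simp [hL2]
  have eb : (fun i => w (g (L (![d, d+1, d+2] i)))) = 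
      fun i => w (![g (τ d), g (τ d + 1), g (τ (d+1))] i) := by
    funext i
    fin_cases i
    · simp [hL1]
    · simp [hL2]
    · simp [hL3]
  have lt1 := hτ (d-1) d (by omega) (by omega)
  have lt2 := hT2 _ (hτT d (by omega)) _ (hτT (d+1) (by omega)) (hτ d (d+1) (by omega) (by omega))
  have lt3 := hT1 _ (hτT (d+1) (by omega))
  have A' : D 2 (fun i => w (![g (τ (d-1)), g (τ d), g (τ d + 1)] i)) < 0 := by
    refine tri_neg hd hu hL (hg _ _ lt1 (by omega)) (hg _ _ (by omega) (by omega)) (hgN _ (by omega)) ?_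
    refine q3.trans_le ?_
    rcases Nat.lt_or_ge (τ (d-1)) (τ d - 1) with h | h
    · rw [dl_max (hg _ _ h (by omega)) (hg _ (τ d) (by omega) (by omega))]
      exact le_max_right _ _
    · rw [show τ d - 1 = τ (d-1) by omega]
  have B' : 0 < D 2 (fun i => w (![g (τ d), g (τ d + 1), g (τ (d+1))] i)) := by
    refine tri_pos hd hu hL (hg _ _ (by omega) (by omega)) (hg _ _ (by omega) (by omega)) (hgN _ (by omega)) ?_
    refine q4.trans_le ?_
    rcases Nat.lt_or_ge (τ d + 2) (τ (d+1)) with h | h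
    · rw [dl_max (hg (τ d + 1) _ (by omega) (by omega)) (hg _ _ h (by omega))]
      exact le_max_left _ _
    · rw [show τ d + 2 = τ (d+1) by omega]
  rw [ea] at A
  rw [eb] at B
  have h1 := (mul_pos_iff_of_pos_right B').1 B
  nlinarith



lemma step (d : ℕ) (hd : 1 ≤ d) : ∃ K : ℕ, ∀ N m u, Good d N m u →
    ∃ w, Good (d+1) (2^N) (K*(2*m+2)) w := by
  obtain ⟨K, hK⟩ := ramsey_all (d+2) (2*d+2)
  refine ⟨K, fun N m u hu => ?_⟩
  obtain ⟨w, hw0, hL⟩ := construct u N d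
  have hgp : ∀ k, 1 ≤ k → k ≤ d+1 → ∀ t : Fin (k+1) → ℕ, StrictMono t → (∀ i, t i < 2^N) →
    D k (fun i => w (t i)) ≠ 0 := by
    intro k hk hkd t ht htN
    obtain ⟨k, rfl⟩ : ∃ k', k = k'+1 := ⟨k-1, by omega⟩
    exact (hL k (by omega) t ht htN).1
  refine ⟨w, hw0, hgp, ?_, ?_⟩
  · intro x y h hy
    have h1 := (hL 0 (by omega) ![x,y] (sm2 h) (by
      intro i; fin_cases i
      · exact h.trans hy
      · exact hy)).2
    rw [D0_eq, hu.one] at h1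
    simpa using h1
  · intro s g hg hgN hh
    set M := K*(2*m+2) with hM
    have hblk : ∀ j, j < K → ∃ i, j*(2*m+2) ≤ i ∧ i + 2 < j*(2*m+2) + 2*m+1 ∧
        dl (g (i+1)) (g (i+2)) < dl (g i) (g (i+1)) ∧
        dl (g (i+1)) (g (i+2)) < dl (g (i+2)) (g (i+3)) := by
      intro j hj
      have hjM : j*(2*m+2) + (2*m+2) ≤ M := by
        have : (j+1)*(2*m+2) ≤ K*(2*m+2) := Nat.mul_le_mul_right _ hj
        rw [hM]; linarith
      generalize j*(2*m+2) = o at hjM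
      rcases block (fun i => dl (g i) (g (i+1))) o m (fun i h1 h2 =>
        dl_ne (hg _ _ (by omega) (by omega)) (hg _ _ (by omega) (by omega))) with h | h | h
      · exact h
      · exact (run_inc hd hu hL s g hg hgN hh (o := o) (by omega) h).elim
      · exact (run_dec hd hu hL s g hg hgN hh (o := o+m) (by omega) h).elim
    choose! X hX using hblk
    have hsep : ∀ i j, i < j → j < K → X i + 1 + 1 < X j + 1 := by
      intro i j hij hj
      have h1 := hX i (hij.trans hj)
      have h2 := hX j hj
      have : (i+1)*(2*m+2) ≤ j*(2*m+2) := Nat.mul_le_mul_right _ hij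
      rw [Nat.add_mul, one_mul] at this
      omega
    have hXM : ∀ j < K, X j + 3 < M := by
      intro j hj
      have h2 := hX j hj
      have : (j+1)*(2*m+2) ≤ K*(2*m+2) := Nat.mul_le_mul_right _ hj
      rw [Nat.add_mul, one_mul] at this
      omega
    let S : Finset ℕ := (Finset.range K).image (fun j => X j + 1)
    have hS : K ≤ S.card := by
      rw [Finset.card_image_of_injOn, Finset.card_range]
      intro i hi j hj hij
      simp only [Finset.coe_range, Set.mem_Iio] at hi hj
      simp only at hij
      by_contra hne
      rcases lt_or_gt_of_ne hne with h | h
      · have := hsep i j h hj; omega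
      · have := hsep j i h hi; omega
    have hSm : ∀ x ∈ S, ∃ j < K, x = X j + 1 := by
      intro x hx
      obtain ⟨j, hj, rfl⟩ := Finset.mem_image.1 hx
      exact ⟨j, Finset.mem_range.1 hj, rfl⟩
    obtain ⟨T, hTS, hTc, hT⟩ := hK (fun i U => ∃ k, ∃ hU : U.card = k+1,
      0 < D k (fun a => w (g (U.orderEmbOfFin hU a)))) S hS
    refine core hd hu hL (fun k h1 h2 => hgp k h1 (by omega)) s g hg hgN hh T hTc ?_ ?_ ?_
    · intro x hx
      obtain ⟨j, hj, rfl⟩ := hSm x (hTS hx)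
      have h1 := hX j hj
      have h2 := hXM j hj
      exact ⟨by omega, by omega, h1.2.2.1, h1.2.2.2⟩
    · intro x hx y hy hxy
      obtain ⟨i, hi, rfl⟩ := hSm x (hTS hx)
      obtain ⟨j, hj, rfl⟩ := hSm y (hTS hy)
      refine hsep i j ?_ hj
      by_contra hne
      rcases lt_or_eq_of_le (not_lt.1 hne) with h | h
      · have := hsep j i h hi; omega
      · subst h; omega
    · intro k hk
      obtain ⟨P, hP⟩ := hT (k+1) (by omega)
      refine ⟨P, fun U hUT hU => ?_⟩
      rw [← hP U hUT hU]
      constructor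
      · intro h; exact ⟨k, hU, h⟩
      · rintro ⟨k', hU', h⟩
        obtain rfl : k' = k := by omega
        exact h

def tw : ℕ → ℕ → ℕ
  | 0, n => n
  | d+1, n => 2 ^ tw d n

lemma main (d : ℕ) : ∃ C : ℕ, 1 ≤ C ∧ ∀ n, 1 ≤ n → ∃ u, Good (d+1) (tw d n) (C*n) u := by
  induction d with
  | zero =>
    refine ⟨2, by norm_num, fun n hn => ?_⟩
    refine ⟨fun x r => if r = 0 then 1 else (x : ℝ), fun x => by simp, ?_, ?_, ?_⟩
    · intro k h1 h2 t ht _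
      obtain rfl : k = 1 := by omega
      rw [D1_eq]
      have : t 0 < t 1 := ht (by decide)
      have : (t 0 : ℝ) < t 1 := by exact_mod_cast this
      simp
      linarith
    · intro x y h _
      rw [D1_eq]
      have : (x : ℝ) < y := by exact_mod_cast h
      simp
      linarith
    · intro s g hg hN _
      have h1 : ∀ i, i < 2*n → i ≤ g i := by
        intro i
        induction i with
        | zero => intro _; omega
        | succ i ih => intro h; have := ih (by omega); have := hg i (i+1) (by omega) h; omega
      have h2 := h1 n (by omega)
      have h3 := hN n (by omega)
      simp only [tw] at h3
      omega
  | succ d ih =>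
    obtain ⟨C, hC, h⟩ := ih
    obtain ⟨K, hK⟩ := step (d+1) (by omega)
    refine ⟨(K+1)*(2*C+2), by nlinarith, fun n hn => ?_⟩
    obtain ⟨u, hu⟩ := h n hn
    obtain ⟨w, hw⟩ := hK _ _ u hu
    refine ⟨w, hw.one, hw.gp, hw.pos, ?_⟩
    intro s g hg hgN hh
    have hle : K*(2*(C*n)+2) ≤ (K+1)*(2*C+2)*n := by
      have : 2*(C*n)+2 ≤ (2*C+2)*n := by nlinarith
      calc K*(2*(C*n)+2) ≤ (K+1)*((2*C+2)*n) := Nat.mul_le_mul (by omega) this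
        _ = _ := by ring
    exact hw.nohom s g (fun i j h1 h2 => hg i j h1 (h2.trans_le hle))
      (fun i hi => hgN i (hi.trans_le hle)) (fun t ht htr => hh t ht (fun i => (htr i).trans_le hle))

end OTP

lemma rtwr_le (d : ℕ) : ∀ (x : ℝ) (m : ℕ), x ≤ m → rtwr (d+1) x ≤ (OTP.tw d m : ℝ) := by
  induction d with
  | zero => intro x m h; simpa [rtwr, OTP.tw] using h
  | succ d ih =>
    intro x m h
    have := ih x m h
    show (2:ℝ) ^ rtwr (d+1) x ≤ ((2 ^ OTP.tw d m : ℕ) : ℝ)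
    push_cast
    rw [← Real.rpow_natCast]
    exact Real.rpow_le_rpow_of_exponent_le (by norm_num) this

lemma Dj_eq_s1 (d : ℕ) (u : ℕ → ℕ → ℝ) (h1 : ∀ x, u x 0 = 1) (x : Fin (d+2) → ℕ) :
    Dj (d+1) (fun a => (fun j : Fin (d+1) => u (x a) (j+1))) = OTP.D (d+1) (fun a => u (x a)) := by
  unfold Dj OTP.D
  congr 1
  ext r i
  simp only [Matrix.of_apply, coordE]
  have hr := r.2
  split_ifs with a b b c e
  · congr 1; omega
  · omega
  · rw [b, h1]
  · congr 1; omega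
  · omega

/-- `OT_d(n) ≥ twr_d(Ω(n))`: for every `d ≥ 1` there are `c > 0` and `n₀` such
that for every `n ≥ n₀` there is a sequence of `⌊twr_d(c·n)⌋` points in general position in
`ℝ^d` with no order-type homogeneous subsequence of length `n`. -/
theorem OT_lower_bound (d : ℕ) (hd : 1 ≤ d) :
    ∃ c : ℝ, 0 < c ∧ ∃ n₀ : ℕ, ∀ n : ℕ, n₀ ≤ n →
      ∃ p : Fin ⌊rtwr d (c * n)⌋₊ → (Fin d → ℝ),
        (∀ t : Fin (d+1) → Fin ⌊rtwr d (c * n)⌋₊, StrictMono t →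
            Dj d (fun a => p (t a)) ≠ 0) ∧
        ¬ ∃ g : Fin n → Fin ⌊rtwr d (c * n)⌋₊,
            StrictMono g ∧ OrderTypeHomog d (fun i => p (g i)) := by
  obtain ⟨d, rfl⟩ : ∃ d', d = d'+1 := ⟨d-1, by omega⟩
  obtain ⟨C, hC, hmain⟩ := OTP.main d
  have hC0 : (0:ℝ) < C := by exact_mod_cast hC
  refine ⟨1 / (2*C), by positivity, C, fun n hn => ?_⟩
  have hn1 : 1 ≤ n / C := (Nat.one_le_div_iff hC).2 hn
  obtain ⟨u, hu⟩ := hmain (n / C) hn1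
  have hle : ⌊rtwr (d+1) (1 / (2*C) * n)⌋₊ ≤ OTP.tw d (n / C) := by
    refine Nat.floor_le_of_le (rtwr_le d _ _ ?_)
    have h1 : n < C * (n / C + 1) := by
      have := Nat.div_add_mod n C
      have := Nat.mod_lt n hC
      rw [Nat.mul_add]; omega
    have h2 : n ≤ C * (2 * (n / C)) := h1.le.trans (Nat.mul_le_mul_left _ (by omega))
    have h3 : (n:ℝ) ≤ C * (2 * ((n / C : ℕ) : ℝ)) := by exact_mod_cast h2
    rw [div_mul_eq_mul_div, one_mul, div_le_iff₀ (by positivity)]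
    linarith
  revert hle
  generalize ⌊rtwr (d+1) (1 / (2*C) * n)⌋₊ = N
  intro hle
  refine ⟨fun x j => u x (j+1), ?_, ?_⟩
  · intro t ht
    rw [Dj_eq_s1 d u hu.one (fun a => (t a : ℕ))]
    exact hu.gp (d+1) (by omega) le_rfl _ (fun a b h => ht h) (fun i => (t i).2.trans_le hle)
  · rintro ⟨g, hg, hom⟩
    have hCn : C * (n / C) ≤ n := Nat.mul_div_le n C
    have hn0 : 0 < n := by omega
    have key : ∀ s : ℝ, (∀ t : Fin (d+2) → Fin n, StrictMono t →
        0 < s * OTP.D (d+1) (fun a => u (g (t a)))) → False := by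
      intro s hs
      refine hu.nohom s (fun i => if h : i < n then g ⟨i, h⟩ else 0) ?_ ?_ ?_
      · intro i j hij hj
        simp only [dif_pos (hj.trans_le hCn), dif_pos ((hij.trans hj).trans_le hCn)]
        exact hg hij
      · intro i hi
        simp only [dif_pos (hi.trans_le hCn)]
        exact (g _).2.trans_le hle
      · intro t ht htr
        have := hs (fun i => ⟨t i, (htr i).trans_le hCn⟩) (fun a b h => ht h)
        have e : ∀ i, t i < n := fun i => (htr i).trans_le hCn
        simpa only [dif_pos (e _)] using this
    rcases hom with h | h
    · refine key 1 fun t ht => ?_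
      have := h t ht
      rw [Dj_eq_s1 d u hu.one (fun a => (g (t a) : ℕ))] at this
      linarith
    · refine key (-1) fun t ht => ?_
      have := h t ht
      rw [Dj_eq_s1 d u hu.one (fun a => (g (t a) : ℕ))] at this
      linarith

end
end

section
/- (Stepping-up lemma of Erdős and Hajnal.) Let k ≥ 3 and n > k, let I = {1, 2, …, N}, and let χ be a two-coloring of the k-element subsets of I such that I has no homogeneous subset of size n under χ (i.e., no n-element subset all of whose k-element subsets receive the same color). Then, under the stepping-up coloring χ' for χ, the lexicographically ordered set J = {0,1}^N contains no homogeneous subset of size 2n + k − 4. -/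
open scoped Classical

noncomputable section

lemma su_spec {N : ℕ} {α β : Fin N → Bool} (h : lexLt α β) :
    ∃ h : dmin α β < N, α ⟨dmin α β, h⟩ = false ∧ β ⟨dmin α β, h⟩ = true ∧
      ∀ j : Fin N, (j : ℕ) < dmin α β → α j = β j := by
  obtain ⟨i, ⟨h1, h2⟩, h3⟩ := h
  have : dmin α β = i := by
    unfold dmin
    apply le_antisymm
    · exact Nat.sInf_le ⟨i.2, by simp [h1, h2]⟩
    · apply le_csInf
      · exact ⟨i, i.2, by simp [h1, h2]⟩
      · rintro b ⟨hb, hne⟩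
        by_contra hlt
        exact hne (h3 ⟨b, hb⟩ (by simpa [Fin.lt_def] using hlt))
  refine ⟨this ▸ i.2, ?_, ?_, ?_⟩
  · simpa [this] using h1
  · simpa [this] using h2
  · intro j hj
    exact h3 j (by rw [this] at hj; exact hj)

lemma su_uniq {N : ℕ} {α β : Fin N → Bool} (d : ℕ) (hd : d < N)
    (h1 : α ⟨d, hd⟩ ≠ β ⟨d, hd⟩) (h3 : ∀ j : Fin N, (j : ℕ) < d → α j = β j) :
    dmin α β = d := by
  unfold dmin
  apply le_antisymm
  · exact Nat.sInf_le ⟨hd, h1⟩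
  · apply le_csInf
    · exact ⟨d, hd, h1⟩
    · rintro b ⟨hb, hne⟩
      by_contra hlt
      exact hne (h3 ⟨b, hb⟩ (by simpa using hlt))

lemma su_min {N : ℕ} {α β γ : Fin N → Bool} (h : lexLt α β) (h' : lexLt β γ) :
    dmin α β ≠ dmin β γ ∧ dmin α γ = min (dmin α β) (dmin β γ) := by
  obtain ⟨p, p1, p2, p3⟩ := su_spec h
  obtain ⟨q, q1, q2, q3⟩ := su_spec h'
  have hne : dmin α β ≠ dmin β γ := by
    intro he
    simp only [he] at p2
    simp [p2] at q1
  refine ⟨hne, ?_⟩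
  rcases lt_or_gt_of_ne hne with hl | hl
  · rw [min_eq_left hl.le]
    apply su_uniq _ p
    · rw [← q3 ⟨_, p⟩ hl, p1, p2]; simp
    · intro j hj
      rw [p3 j hj, q3 j (hj.trans hl)]
  · rw [min_eq_right hl.le]
    apply su_uniq _ q
    · rw [p3 ⟨_, q⟩ hl, q1, q2]; simp
    · intro j hj
      rw [p3 j (hj.trans hl), q3 j hj]

lemma su_enum {N : ℕ} (T : Finset (Fin N → Bool)) :
    ∃ a : ℕ → (Fin N → Bool), (∀ i, i < T.card → a i ∈ T) ∧
      ∀ i j, i < j → j < T.card → lexLt (a i) (a j) := by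
  let T' : Finset (Lex (Fin N → Bool)) := T.map toLex.toEmbedding
  have hc : T'.card = T.card := by simp [T']
  let e := T'.orderEmbOfFin hc
  refine ⟨fun i => if h : i < T.card then ofLex (e ⟨i, h⟩) else fun _ => false, ?_, ?_⟩
  · intro i hi
    have := T'.orderEmbOfFin_mem hc ⟨i, hi⟩
    simp only [hi, dite_true]
    obtain ⟨x, hx, hx'⟩ := Finset.mem_map.1 this
    have : ofLex (e ⟨i, hi⟩) = x := by
      change ofLex (T'.orderEmbOfFin hc ⟨i, hi⟩) = x
      rw [← hx']; rfl
    rw [this]; exact hx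
  · intro i j hij hj
    have hi := hij.trans hj
    simp only [hi, hj, dite_true]
    have : e ⟨i, hi⟩ < e ⟨j, hj⟩ := e.strictMono (by simpa using hij)
    obtain ⟨d, h1, h2⟩ := this
    refine ⟨d, ?_, fun j hj => h1 j hj⟩
    exact Bool.lt_iff.1 h2

lemma su_inc {N M : ℕ} {a : ℕ → (Fin N → Bool)}
    (ha : ∀ i j, i < j → j < M → lexLt (a i) (a j)) {s e : ℕ} (heM : e < M)
    (hm : ∀ i, s ≤ i → i + 1 < e → dmin (a i) (a (i+1)) < dmin (a (i+1)) (a (i+2))) :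
    (∀ i j, s ≤ i → i < j → j ≤ e → dmin (a i) (a j) = dmin (a i) (a (i+1))) ∧
    (∀ i j, s ≤ i → i < j → j < e → dmin (a i) (a (i+1)) < dmin (a j) (a (j+1))) := by
  have h2 : ∀ i j, s ≤ i → i < j → j < e →
      dmin (a i) (a (i+1)) < dmin (a j) (a (j+1)) := by
    intro i j hi hij
    induction j, hij using Nat.le_induction with
    | base => intro h; exact hm i hi h
    | succ j hj ih =>
      intro h
      exact (ih (by omega)).trans (hm j (by omega) h)
  refine ⟨?_, h2⟩
  intro i j hi hij
  induction j, hij using Nat.le_induction with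
  | base => intro _; rfl
  | succ j hj ih =>
    intro h
    rw [(su_min (ha i j (by omega) (by omega)) (ha j (j+1) (by omega) (by omega))).2,
      ih (by omega)]
    exact min_eq_left (h2 i j hi (by omega) (by omega)).le

lemma su_dec {N M : ℕ} {a : ℕ → (Fin N → Bool)}
    (ha : ∀ i j, i < j → j < M → lexLt (a i) (a j)) {s e : ℕ} (heM : e < M)
    (hm : ∀ i, s ≤ i → i + 1 < e → dmin (a (i+1)) (a (i+2)) < dmin (a i) (a (i+1))) :
    (∀ i j, s ≤ i → i ≤ j → j < e → dmin (a i) (a (j+1)) = dmin (a j) (a (j+1))) ∧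
    (∀ i j, s ≤ i → i < j → j < e → dmin (a j) (a (j+1)) < dmin (a i) (a (i+1))) := by
  have h2 : ∀ i j, s ≤ i → i < j → j < e →
      dmin (a j) (a (j+1)) < dmin (a i) (a (i+1)) := by
    intro i j hi hij
    induction j, hij using Nat.le_induction with
    | base => intro h; exact hm i hi h
    | succ j hj ih =>
      intro h
      exact (hm j (by omega) h).trans (ih (by omega))
  refine ⟨?_, h2⟩
  intro i j hi hij
  induction j, hij using Nat.le_induction with
  | base => intro _; rfl
  | succ j hj ih =>
    intro h
    rw [(su_min (ha i (j+1) (by omega) (by omega)) (ha (j+1) (j+2) (by omega) (by omega))).2,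
      ih (by omega)]
    exact min_eq_right (hm j (by omega) h).le

/-- Given a monotone run, build the homogeneous set. -/
lemma su_build (k n N : ℕ) (hk : 3 ≤ k)
    (χ : Finset ℕ → Fin 2)
    (hχ : ¬ ∃ S : Finset ℕ, S ⊆ Finset.range N ∧ S.card = n ∧
        ∀ A B : Finset ℕ, A ⊆ S → B ⊆ S → A.card = k → B.card = k → χ A = χ B)
    (c : Fin 2) (M : ℕ) (a : ℕ → (Fin N → Bool))
    (ha : ∀ i j, i < j → j < M → lexLt (a i) (a j))
    (hc : ∀ t : Fin (k+1) → ℕ, StrictMono t → (∀ i, t i < M) →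
      stepUp k hk χ (fun i => a (t i)) = c)
    (s : ℕ) (hs : s + n < M)
    (hinj : Set.InjOn (fun i => dmin (a i) (a (i+1))) (Set.Ico s (s+n)))
    (hex : ∀ e : Fin k → ℕ, StrictMono e → (∀ i, s ≤ e i ∧ e i < s + n) →
      ∃ t : Fin (k+1) → ℕ, StrictMono t ∧ (∀ i, t i < M) ∧
        (∀ l : Fin k, dmin (a (t l.castSucc)) (a (t l.succ)) = dmin (a (e l)) (a (e l + 1))) ∧
        (StrictMono (fun l => dmin (a (e l)) (a (e l + 1))) ∨
          StrictAnti (fun l => dmin (a (e l)) (a (e l + 1))))) : False := by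
  set δ : ℕ → ℕ := fun i => dmin (a i) (a (i+1)) with hδ
  have key : ∀ A : Finset ℕ, A ⊆ (Finset.Ico s (s+n)).image δ → A.card = k → χ A = c := by
    intro A hA hAk
    obtain ⟨B, hB, rfl⟩ := Finset.subset_image_iff.1 hA
    have hB' : (B : Set ℕ) ⊆ Set.Ico s (s+n) :=
      fun x hx => by simpa using hB hx
    have hBk : B.card = k := by
      rw [← hAk, Finset.card_image_of_injOn (hinj.mono hB')]
    obtain ⟨t, ht, htM, htd, hmono⟩ := hex (B.orderEmbOfFin hBk) (B.orderEmbOfFin hBk).strictMono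
      (fun i => by simpa using hB' (B.orderEmbOfFin_mem hBk i))
    rw [← hc t ht htM]
    unfold stepUp
    simp only [htd]
    rw [if_pos hmono]
    congr 1
    have : B = Finset.image (B.orderEmbOfFin hBk) Finset.univ := by
      simp
    conv_lhs => rw [this]
    rw [Finset.image_image]
    rfl
  apply hχ
  refine ⟨(Finset.Ico s (s+n)).image δ, ?_, ?_, ?_⟩
  · intro x hx
    obtain ⟨i, hi, rfl⟩ := Finset.mem_image.1 hx
    rw [Finset.mem_Ico] at hi
    obtain ⟨h, -⟩ := su_spec (ha i (i+1) (by omega) (by omega))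
    simpa using h
  · rw [Finset.card_image_of_injOn (by simpa using hinj)]; simp
  · intro A B hA hB hAk hBk
    rw [key A hA hAk, key B hB hBk]

/-- Stepping-up lemma of Erdős and Hajnal: if the coloring `χ` of `k`-element
subsets of `{0, …, N-1}` admits no homogeneous set of size `n`, then the stepping-up coloring
`χ'` of `(k+1)`-tuples of `{0,1}^N` (ordered lexicographically) admits no homogeneous set of
size `2n + k - 4`. -/
theorem stepping_up_lemma (k n N : ℕ) (hk : 3 ≤ k) (hn : k < n)
    (χ : Finset ℕ → Fin 2)
    (hχ : ¬ ∃ S : Finset ℕ, S ⊆ Finset.range N ∧ S.card = n ∧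
        ∀ A B : Finset ℕ, A ⊆ S → B ⊆ S → A.card = k → B.card = k → χ A = χ B) :
    ¬ ∃ T : Finset (Fin N → Bool), T.card = 2 * n + k - 4 ∧
        ∀ A B : Fin (k+1) → (Fin N → Bool), LexMono A → LexMono B →
          (∀ i, A i ∈ T) → (∀ i, B i ∈ T) →
            stepUp k hk χ A = stepUp k hk χ B := by
  rintro ⟨T, hT, hom⟩
  obtain ⟨a, haT, ha⟩ := su_enum T
  rw [hT] at haT ha
  set M := 2 * n + k - 4 with hM
  obtain ⟨c, hc⟩ : ∃ c : Fin 2, ∀ t : Fin (k+1) → ℕ, StrictMono t → (∀ i, t i < M) →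
      stepUp k hk χ (fun i => a (t i)) = c := by
    refine ⟨stepUp k hk χ (fun i => a i), fun t ht htM => ?_⟩
    apply hom
    · intro i j hij; exact ha _ _ (ht hij) (htM j)
    · intro i j hij; exact ha _ _ hij (by have := j.2; omega)
    · intro i; exact haT _ (htM i)
    · intro i; exact haT _ (by have := i.2; omega)
  have hne : ∀ i, i + 2 < M → dmin (a i) (a (i+1)) ≠ dmin (a (i+1)) (a (i+2)) := fun i hi =>
    (su_min (ha i (i+1) (by omega) (by omega)) (ha (i+1) (i+2) (by omega) (by omega))).1
  have noInc : ∀ s, s + n < M → (∀ i, s ≤ i → i + 1 < s + n →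
      dmin (a i) (a (i+1)) < dmin (a (i+1)) (a (i+2))) → False := by
    intro s hs hm
    obtain ⟨h1, h2⟩ := su_inc ha hs hm
    refine su_build k n N hk χ hχ c M a ha hc s hs ?_ ?_
    · intro i hi j hj hij
      simp only [Set.mem_Ico] at hi hj hij
      rcases lt_trichotomy i j with h | h | h
      · have := h2 i j hi.1 h hj.2; omega
      · exact h
      · have := h2 j i hj.1 h hi.2; omega
    · intro e he hr
      have hlt : ∀ l : Fin k, e l < (Fin.snoc e (s+n) : Fin (k+1) → ℕ) l.succ ∧
          (Fin.snoc e (s+n) : Fin (k+1) → ℕ) l.succ ≤ s + n := by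
        intro l
        rcases Fin.eq_castSucc_or_eq_last l.succ with ⟨j, hj⟩ | hj
        · rw [hj, Fin.snoc_castSucc]
          refine ⟨he ?_, (hr j).2.le⟩
          have := congrArg Fin.val hj
          simp at this
          rw [Fin.lt_def]; omega
        · rw [hj, Fin.snoc_last]; exact ⟨(hr l).2, le_rfl⟩
      refine ⟨Fin.snoc e (s+n), ?_, ?_, ?_, ?_⟩
      · rw [Fin.strictMono_iff_lt_succ]
        intro l
        rw [Fin.snoc_castSucc]
        exact (hlt l).1
      · intro i
        rcases Fin.eq_castSucc_or_eq_last i with ⟨j, hj⟩ | hj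
        · rw [hj, Fin.snoc_castSucc]; have := (hr j).2; omega
        · rw [hj, Fin.snoc_last]; exact hs
      · intro l
        rw [Fin.snoc_castSucc]
        exact h1 _ _ (hr l).1 (hlt l).1 (hlt l).2
      · left
        intro i j hij
        exact h2 _ _ (hr i).1 (he hij) (hr j).2
  have noDec : ∀ s, s + n < M → (∀ i, s ≤ i → i + 1 < s + n →
      dmin (a (i+1)) (a (i+2)) < dmin (a i) (a (i+1))) → False := by
    intro s hs hm
    obtain ⟨h1, h2⟩ := su_dec ha hs hm
    refine su_build k n N hk χ hχ c M a ha hc s hs ?_ ?_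
    · intro i hi j hj hij
      simp only [Set.mem_Ico] at hi hj hij
      rcases lt_trichotomy i j with h | h | h
      · have := h2 i j hi.1 h hj.2; omega
      · exact h
      · have := h2 j i hj.1 h hi.2; omega
    · intro e he hr
      have hlt : ∀ l : Fin k, s ≤ (Fin.cons s (fun i => e i + 1) : Fin (k+1) → ℕ) l.castSucc ∧
          (Fin.cons s (fun i => e i + 1) : Fin (k+1) → ℕ) l.castSucc ≤ e l := by
        intro l
        rcases Fin.eq_zero_or_eq_succ l.castSucc with hj | ⟨j, hj⟩
        · rw [hj, Fin.cons_zero]; exact ⟨le_rfl, (hr l).1⟩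
        · rw [hj, Fin.cons_succ]
          have h3 : e j < e l := he (by
            have := congrArg Fin.val hj
            simp at this
            rw [Fin.lt_def]; omega)
          have := (hr j).1
          omega
      refine ⟨Fin.cons s (fun i => e i + 1), ?_, ?_, ?_, ?_⟩
      · rw [Fin.strictMono_iff_lt_succ]
        intro l
        rw [Fin.cons_succ]
        have := (hlt l).2
        omega
      · intro i
        rcases Fin.eq_zero_or_eq_succ i with hj | ⟨j, hj⟩
        · rw [hj, Fin.cons_zero]; omega
        · rw [hj, Fin.cons_succ]; have := (hr j).2; omega
      · intro l
        rw [Fin.cons_succ]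
        exact h1 _ _ (hlt l).1 (hlt l).2 (hr l).2
      · right
        intro i j hij
        exact h2 _ _ (hr i).1 (he hij) (hr j).2
  -- colour of consecutive tuples
  have hcons : ∀ i, i + k < M → stepUp k hk χ (fun j : Fin (k+1) => a (i + j)) = c := by
    intro i hi
    exact hc (fun j => i + j) (fun x y h => by simpa using h) (fun j => by have := j.2; omega)
  have hmax : ∀ i, i + k < M → dmin (a i) (a (i+1)) < dmin (a (i+1)) (a (i+2)) →
      dmin (a (i+2)) (a (i+3)) < dmin (a (i+1)) (a (i+2)) → c = 1 := by
    intro i hi h1 h2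
    rw [← hcons i hi]
    unfold stepUp
    dsimp only
    rw [if_neg, if_pos]
    · exact ⟨h1, h2⟩
    · rintro (h | h)
      · have := @h ⟨1, by omega⟩ ⟨2, by omega⟩ (by simp)
        exact absurd h2 (not_lt.2 (le_of_lt this))
      · have := @h ⟨0, by omega⟩ ⟨1, by omega⟩ (by simp)
        exact absurd h1 (not_lt.2 (le_of_lt this))
  have hmin : ∀ i, i + k < M → dmin (a (i+1)) (a (i+2)) < dmin (a i) (a (i+1)) →
      dmin (a (i+1)) (a (i+2)) < dmin (a (i+2)) (a (i+3)) → c = 0 := by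
    intro i hi h1 h2
    rw [← hcons i hi]
    unfold stepUp
    dsimp only
    rw [if_neg, if_neg]
    · rintro ⟨h, -⟩
      exact absurd h1 (not_lt.2 (le_of_lt h))
    · rintro (h | h)
      · have := @h ⟨0, by omega⟩ ⟨1, by omega⟩ (by simp)
        exact absurd h1 (not_lt.2 (le_of_lt this))
      · have := @h ⟨1, by omega⟩ ⟨2, by omega⟩ (by simp)
        exact absurd h2 (not_lt.2 (le_of_lt this))
  have tri : ∀ i, i + 2 < M → dmin (a i) (a (i+1)) < dmin (a (i+1)) (a (i+2)) ∨
      dmin (a (i+1)) (a (i+2)) < dmin (a i) (a (i+1)) := fun i hi => lt_or_gt_of_ne (hne i hi)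
  by_cases hc1 : c = 1
  · -- no local minimum: decreasing going backwards is impossible
    have stepF : ∀ i, i + k < M → dmin (a (i+1)) (a (i+2)) < dmin (a i) (a (i+1)) →
        dmin (a (i+2)) (a (i+3)) < dmin (a (i+1)) (a (i+2)) := by
      intro i hi h
      rcases tri (i+1) (by omega) with h' | h'
      · have := hmin i hi h h'
        rw [hc1] at this; exact absurd this (by decide)
      · exact h'
    have prop : ∀ i j, i ≤ j → j + k ≤ M →
        dmin (a (i+1)) (a (i+2)) < dmin (a i) (a (i+1)) →
        dmin (a (j+1)) (a (j+2)) < dmin (a j) (a (j+1)) := by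
      intro i j hij
      induction j, hij using Nat.le_induction with
      | base => intro _ h; exact h
      | succ j hj ih => intro h h'; exact stepF j (by omega) (ih (by omega) h')
    rcases tri (n-2) (by omega) with h | h
    · refine noInc 0 (by omega) (fun i _ hi => ?_)
      rcases tri i (by omega) with h' | h'
      · exact h'
      · exact absurd (prop i (n-2) (by omega) (by omega) h') (not_lt.2 h.le)
    · exact noDec (n-2) (by omega) (fun i hi hi' => prop (n-2) i hi (by omega) h)
  · have stepF : ∀ i, i + k < M → dmin (a i) (a (i+1)) < dmin (a (i+1)) (a (i+2)) →
        dmin (a (i+1)) (a (i+2)) < dmin (a (i+2)) (a (i+3)) := by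
      intro i hi h
      rcases tri (i+1) (by omega) with h' | h'
      · exact h'
      · exact absurd (hmax i hi h h') hc1
    have prop : ∀ i j, i ≤ j → j + k ≤ M →
        dmin (a i) (a (i+1)) < dmin (a (i+1)) (a (i+2)) →
        dmin (a j) (a (j+1)) < dmin (a (j+1)) (a (j+2)) := by
      intro i j hij
      induction j, hij using Nat.le_induction with
      | base => intro _ h; exact h
      | succ j hj ih => intro h h'; exact stepF j (by omega) (ih (by omega) h')
    rcases tri (n-2) (by omega) with h | h
    · exact noInc (n-2) (by omega) (fun i hi hi' => prop (n-2) i hi (by omega) h)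
    · refine noDec 0 (by omega) (fun i _ hi => ?_)
      rcases tri i (by omega) with h' | h'
      · exact absurd (prop i (n-2) (by omega) (by omega) h') (not_lt.2 h.le)
      · exact h'
end
end

section
/- Let P = (p_1, …, p_N) be a sequence of points in ℝ^d, and for ε > 0 and α ∈ {0,1}^N define q_α(ε) := Σ_{i=1}^N α_i ε^i (1, p_{i,1}, …, p_{i,d}) ∈ ℝ^{d+1}. Then for any two distinct binary vectors α, β ∈ {0,1}^N, the limit as ε → 0⁺ of σδ(q_α(ε), q_β(ε)) exists and equals p_{δ(α,β)}, where δ(α,β) = min{ i : α_i ≠ β_i }. -/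
open scoped Classical

noncomputable section

theorem qpt_sub_aux (d N : ℕ) (p : Fin N → (Fin d → ℝ)) (α β : Fin N → Bool)
    (i : Fin N) (hi : α i ≠ β i) (hmin : ∀ j : Fin N, j < i → α j = β j) (k : Fin (d+1)) :
    ∃ G : ℝ → ℝ, Continuous G ∧
      G 0 = ((if α i then (1:ℝ) else 0) - (if β i then 1 else 0)) *
        (Fin.cons 1 (p i) : Fin (d+1) → ℝ) k ∧
      ∀ ε : ℝ, qpt p α ε k - qpt p β ε k = ε ^ ((i : ℕ) + 1) * G ε := by
  refine ⟨fun ε => ∑ j : Fin N, ((if α j then (1:ℝ) else 0) - (if β j then 1 else 0)) *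
    ε ^ ((j : ℕ) - (i : ℕ)) * (Fin.cons 1 (p j) : Fin (d+1) → ℝ) k, by fun_prop, ?_, ?_⟩
  · simp only
    rw [Finset.sum_eq_single i]
    · simp
    · intro j _ hj
      rcases lt_or_gt_of_ne hj with h | h
      · rw [hmin j h]; simp
      · have h' : (j : ℕ) - (i : ℕ) ≠ 0 := by
          have : (i : ℕ) < j := h
          omega
        rw [zero_pow h']; simp
    · simp
  · intro ε
    simp only [qpt]
    rw [← Finset.sum_sub_distrib, Finset.mul_sum]
    refine Finset.sum_congr rfl fun j _ => ?_
    rcases lt_or_ge j i with h | h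
    · rw [hmin j h]; simp
    · have h' : (j : ℕ) + 1 = ((i : ℕ) + 1) + ((j : ℕ) - (i : ℕ)) := by
        have : (i : ℕ) ≤ j := h
        omega
      rw [h', pow_add]
      split_ifs <;> ring

/-- for distinct binary vectors `α, β`, the limit of `σδ(q_α(ε), q_β(ε))` as
`ε → 0⁺` exists and equals `p_{δ(α,β)}`, where `δ(α,β)` is the first index where `α` and `β`
differ. -/
theorem sdel_limit (d N : ℕ) (p : Fin N → (Fin d → ℝ)) (α β : Fin N → Bool)
    (i : Fin N) (hi : α i ≠ β i) (hmin : ∀ j : Fin N, j < i → α j = β j) :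
    Filter.Tendsto (fun ε : ℝ => sdel2 (qpt p α ε) (qpt p β ε))
      (nhdsWithin 0 (Set.Ioi 0)) (nhds (p i)) := by
  rw [tendsto_pi_nhds]
  intro k
  obtain ⟨G, hG, hG0, hGe⟩ := qpt_sub_aux d N p α β i hi hmin k.succ
  obtain ⟨H, hH, hH0, hHe⟩ := qpt_sub_aux d N p α β i hi hmin 0
  have hc : ((if α i then (1:ℝ) else 0) - (if β i then 1 else 0)) ≠ 0 := by
    revert hi
    cases α i <;> cases β i <;> simp
  rw [Fin.cons_succ] at hG0
  rw [Fin.cons_zero, mul_one] at hH0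
  have h1 : Filter.Tendsto (fun ε => G ε / H ε) (nhdsWithin 0 (Set.Ioi 0)) (nhds (p i k)) := by
    have h2 := (hG.tendsto 0).div (hH.tendsto 0) (by rw [hH0]; exact hc)
    rw [hG0, hH0, mul_div_cancel_left₀ _ hc] at h2
    exact h2.mono_left nhdsWithin_le_nhds
  refine h1.congr' ?_
  filter_upwards [self_mem_nhdsWithin] with ε hε
  have hε' : ε ^ ((i : ℕ) + 1) ≠ 0 := pow_ne_zero _ (ne_of_gt hε)
  simp only [sdel2]
  rw [hGe, hHe, mul_div_mul_left _ _ hε']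

end
end

section
/- A point sequence (p_1, …, p_n) in ℝ^d in strong general position (for each 1 ≤ j ≤ d and each increasing (j+1)-tuple of indices i_1 < … < i_{j+1}, D_j(p_{i_1}, …, p_{i_{j+1}}) ≠ 0) is super-monotone if and only if it is super-order-type homogeneous. -/
open scoped Classical

noncomputable section

/-- orientation determinant -/
def EE (j : ℕ) (T : Fin (j+1) → ℕ → ℝ) : ℝ :=
  Matrix.det (Matrix.of (fun (i r : Fin (j+1)) => (Fin.cons 1 (fun k : Fin j => T i k) : Fin (j+1) → ℝ) r))

lemma EE_diff (j : ℕ) (T : Fin (j+2) → ℕ → ℝ) :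
    EE (j+1) T = Matrix.det (Matrix.of (fun (i r : Fin (j+1)) => T i.succ r - T i.castSucc r)) := by
  unfold EE
  rw [Matrix.det_eq_of_forall_row_eq_smul_add_pred (B := Matrix.of
    (fun (i : Fin (j+2)) (r : Fin (j+2)) =>
      (Fin.cons (Fin.cons 1 (fun k : Fin (j+1) => T 0 k))
        (fun i : Fin (j+1) => Fin.cons 0 (fun r : Fin (j+1) => T i.succ r - T i.castSucc r)) :
          Fin (j+2) → Fin (j+2) → ℝ) i r)) (fun _ => 1)]
  · rw [Matrix.det_succ_column_zero, Fin.sum_univ_succ]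
    simp
    rfl
  · intro r
    simp
  · intro i r
    refine Fin.cases ?_ (fun r => ?_) r <;> simp

/-- slopes -/
def slo (P : ℕ → ℕ → ℝ) (l : ℕ) : ℕ → ℝ := sdelStep (P l) (P (l+1))

lemma slo_mul (P : ℕ → ℕ → ℝ) (l j : ℕ) (h : P (l+1) 0 - P l 0 ≠ 0) (r : Fin (j+1)) :
    (P (l+1) 0 - P l 0) * (Fin.cons 1 (fun k : Fin j => slo P l k) : Fin (j+1) → ℝ) r
      = P (l+1) r - P l r := by
  refine Fin.cases ?_ (fun r => ?_) r
  · simp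
  · have h' : P l 0 - P (l+1) 0 ≠ 0 := fun h2 => h (by linarith)
    simp only [Fin.cons_succ, slo, sdelStep, Fin.val_succ]
    field_simp
    ring

lemma EE_sum (P : ℕ → ℕ → ℝ) (j : ℕ) (t : Fin (j+2) → ℕ) (ht : StrictMono t)
    (hd : ∀ l, l < t (Fin.last _) → P (l+1) 0 - P l 0 ≠ 0) :
    EE (j+1) (fun i => P (t i)) =
      ∑ r ∈ Fintype.piFinset (fun i : Fin (j+1) => Finset.Ico (t i.castSucc) (t i.succ)),
        (∏ i, (P (r i + 1) 0 - P (r i) 0)) * EE j (fun i => slo P (r i)) := by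
  rw [EE_diff]
  have key : (Matrix.of (fun (i r : Fin (j+1)) => P (t i.succ) r - P (t i.castSucc) r))
      = fun i => ∑ l ∈ Finset.Ico (t i.castSucc) (t i.succ),
        (P (l+1) 0 - P l 0) • (Fin.cons 1 (fun k : Fin j => slo P l k) : Fin (j+1) → ℝ) := by
    funext i r
    rw [Finset.sum_apply]
    simp only [Matrix.of_apply, Pi.smul_apply, smul_eq_mul]
    rw [← Finset.sum_Ico_sub (fun l => P l r) (ht (Fin.castSucc_lt_succ (i := i))).le]
    refine Finset.sum_congr rfl fun l hl => ?_
    rw [slo_mul]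
    apply hd
    exact lt_of_lt_of_le (Finset.mem_Ico.1 hl).2 (ht.monotone (Fin.le_last _))
  rw [key]
  have := (Matrix.detRowAlternating (n := Fin (j+1)) (R := ℝ)).toMultilinearMap.map_sum_finset
    (fun i l => (P (l+1) 0 - P l 0) • (Fin.cons 1 (fun k : Fin j => slo P l k) : Fin (j+1) → ℝ))
    (fun i : Fin (j+1) => Finset.Ico (t i.castSucc) (t i.succ))
  refine Eq.trans this ?_
  refine Finset.sum_congr rfl fun r _ => ?_
  rw [MultilinearMap.map_smul_univ]
  rfl

def SMc (d n : ℕ) (P : ℕ → ℕ → ℝ) : Prop :=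
  ∀ j, j < d → ∃ e : ℝ, (e = 1 ∨ e = -1) ∧ ∀ a, a + j + 1 < n →
    0 < e * (sdel j (fun i => P (a + 1 + i)) 0 - sdel j (fun i => P (a + i)) 0)

def OTc (d n : ℕ) (P : ℕ → ℕ → ℝ) : Prop :=
  ∀ j, j < d → ∃ e : ℝ, (e = 1 ∨ e = -1) ∧ ∀ t : Fin (j+2) → ℕ, StrictMono t →
    t (Fin.last _) < n → 0 < e * EE (j+1) (fun i => P (t i))

def COc (d n : ℕ) (P : ℕ → ℕ → ℝ) : Prop :=
  ∀ j, j < d → ∃ e : ℝ, (e = 1 ∨ e = -1) ∧ ∀ a, a + j + 1 < n →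
    0 < e * EE (j+1) (fun i => P (a + i))

lemma sdel_slo (m : ℕ) : ∀ q : Fin (m+2) → ℕ → ℝ,
    sdel (m+1) q = sdel m (fun i => sdelStep (q i.castSucc) (q i.succ)) := by
  induction m with
  | zero => intro q; rfl
  | succ m ih =>
    intro q
    rw [sdel, ih, ih, sdel]
    rfl

lemma sdel_win (m a : ℕ) (P : ℕ → ℕ → ℝ) :
    sdel (m+1) (fun i => P (a + i)) = sdel m (fun i => slo P (a + i)) := by
  rw [sdel_slo]; rfl

lemma EE_one (P : ℕ → ℕ → ℝ) (t : Fin 2 → ℕ) :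
    EE 1 (fun i => P (t i)) = P (t 1) 0 - P (t 0) 0 := by
  rw [EE_diff]; simp

lemma sgn_prod {e : ℝ} (he : e = 1 ∨ e = -1) (m : ℕ) (f : Fin m → ℝ) (h : ∀ i, 0 < e * f i) :
    0 < e ^ m * ∏ i, f i := by
  have := Finset.prod_pos (s := Finset.univ) (fun i _ => h i)
  rwa [Finset.prod_mul_distrib, Finset.prod_const, Finset.card_univ, Fintype.card_fin] at this

lemma sgn_pow {e e' : ℝ} (he : e = 1 ∨ e = -1) (he' : e' = 1 ∨ e' = -1) (m : ℕ) :
    e ^ m * e' = 1 ∨ e ^ m * e' = -1 := by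
  rcases he with rfl | rfl <;> rcases he' with rfl | rfl <;>
    rcases neg_one_pow_eq_or ℝ m with h | h <;> simp [h]

lemma sgn_ne {e x : ℝ} (h : 0 < e * x) : x ≠ 0 := by
  rintro rfl; simp at h

lemma SM_OT (d : ℕ) : ∀ (n : ℕ) (P : ℕ → ℕ → ℝ), SMc d n P → OTc d n P := by
  induction d with
  | zero => intro n P _ j hj; omega
  | succ d ih =>
    intro n P h j hj
    obtain ⟨e, he, h0⟩ := h 0 (by omega)
    have h0' : ∀ a, a + 1 < n → 0 < e * (P (a+1) 0 - P a 0) := fun a ha => by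
      simpa [sdel] using h0 a (by omega)
    have hS : SMc d (n-1) (slo P) := by
      intro j hj
      obtain ⟨e, he, h1⟩ := h (j+1) (by omega)
      refine ⟨e, he, fun a ha => ?_⟩
      have := h1 a (by omega)
      rwa [sdel_win, sdel_win] at this
    have hO := ih _ _ hS
    have main : ∃ e' : ℝ, (e' = 1 ∨ e' = -1) ∧ ∀ t : Fin (j+1) → ℕ, StrictMono t →
        t (Fin.last _) < n - 1 → 0 < e' * EE j (fun i => slo P (t i)) := by
      cases j with
      | zero => exact ⟨1, Or.inl rfl, fun t _ _ => by simp [EE]⟩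
      | succ j => exact hO j (by omega)
    obtain ⟨e', he', h1⟩ := main
    refine ⟨e ^ (j+1) * e', sgn_pow he he' _, fun t ht htn => ?_⟩
    rw [EE_sum P j t ht (fun l hl => sgn_ne (h0' l (by omega))), Finset.mul_sum]
    apply Finset.sum_pos
    · intro r hr
      rw [Fintype.mem_piFinset] at hr
      have hr' : ∀ i, t i.castSucc ≤ r i ∧ r i < t i.succ := fun i => Finset.mem_Ico.1 (hr i)
      have hlt : ∀ i, r i < t (Fin.last _) := fun i =>
        lt_of_lt_of_le (hr' i).2 (ht.monotone (Fin.le_last _))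
      have a1 := sgn_prod he (j+1) (fun i => P (r i + 1) 0 - P (r i) 0)
        (fun i => h0' _ (by have := hlt i; omega))
      have a2 := h1 r (by
        intro a b hab
        refine lt_of_lt_of_le (hr' a).2 (le_trans (ht.monotone ?_) (hr' b).1)
        rw [Fin.le_def]; simpa using hab) (by have := hlt (Fin.last _); omega)
      have := mul_pos a1 a2
      calc _ < _ := this
        _ = _ := by ring
    · refine ⟨fun i => t i.castSucc, ?_⟩
      rw [Fintype.mem_piFinset]
      intro i
      exact Finset.mem_Ico.2 ⟨le_rfl, ht (Fin.castSucc_lt_succ (i := i))⟩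

lemma EE_win (P : ℕ → ℕ → ℝ) (j a : ℕ) (hd : ∀ l, l < a + j + 1 → P (l+1) 0 - P l 0 ≠ 0) :
    EE (j+1) (fun i => P (a + i)) =
      (∏ i : Fin (j+1), (P (a + i + 1) 0 - P (a + i) 0)) * EE j (fun i => slo P (a + i)) := by
  rw [EE_sum P j (fun i => a + i) (fun x y h => by simpa using h)
    (fun l hl => hd l (by simpa [add_assoc] using hl))]
  rw [Finset.sum_eq_single_of_mem (fun i : Fin (j+1) => a + (i : ℕ))]
  · rw [Fintype.mem_piFinset]; intro i; simp
  · intro b hb hne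
    exfalso
    apply hne
    funext i
    have := Fintype.mem_piFinset.1 hb i
    simp at this
    omega

lemma CO_SM (d : ℕ) : ∀ (n : ℕ) (P : ℕ → ℕ → ℝ), COc d n P → SMc d n P := by
  induction d with
  | zero => intro n P _ j hj; omega
  | succ d ih =>
    intro n P h
    obtain ⟨e, he, h0⟩ := h 0 (by omega)
    have h0' : ∀ a, a + 1 < n → 0 < e * (P (a+1) 0 - P a 0) := fun a ha => by
      have := h0 a (by omega)
      rw [EE_one P (fun i => a + i)] at this
      simpa using this
    have hS : COc d (n-1) (slo P) := by
      intro j hj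
      obtain ⟨e', he', h1⟩ := h (j+1) (by omega)
      refine ⟨e ^ (j+2) * e', sgn_pow he he' _, fun a ha => ?_⟩
      have a1 := h1 a (by omega)
      rw [EE_win P (j+1) a (fun l hl => sgn_ne (h0' l (by omega)))] at a1
      have a2 := sgn_prod he (j+2) (fun i => P (a + i + 1) 0 - P (a + i) 0)
        (fun i => h0' _ (by have := i.2; omega))
      have a3 := mul_pos a1 a2
      have a4 := mul_self_pos.2 (sgn_ne a2)
      refine pos_of_mul_pos_left (b := (∏ i : Fin (j+2), (P (a + i + 1) 0 - P (a + i) 0)) * (∏ i : Fin (j+2), (P (a + i + 1) 0 - P (a + i) 0))) ?_ a4.le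
      calc _ < _ := a3
        _ = _ := by ring
    have hM := ih _ _ hS
    intro j hj
    cases j with
    | zero => exact ⟨e, he, fun a ha => by simpa [sdel] using h0' a (by omega)⟩
    | succ j =>
      obtain ⟨e', he', h1⟩ := hM j (by omega)
      refine ⟨e', he', fun a ha => ?_⟩
      rw [sdel_win, sdel_win]
      exact h1 a (by omega)

lemma OT_CO (d n : ℕ) (P : ℕ → ℕ → ℝ) (h : OTc d n P) : COc d n P := by
  intro j hj
  obtain ⟨e, he, h1⟩ := h j hj
  exact ⟨e, he, fun a ha => h1 (fun i => a + i) (fun x y h => by simpa using h)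
    (by simp; omega)⟩

lemma Dj_EE {d n : ℕ} (p : Fin n → (Fin d → ℝ)) (j : ℕ) (t : Fin (j+2) → Fin n) :
    Dj (j+1) (fun a => p (t a)) = EE (j+1) (fun a => pext p (t a)) := by
  unfold Dj EE
  rw [← Matrix.det_transpose]
  congr 1
  ext i r
  refine Fin.cases ?_ (fun r => ?_) r
  · simp
  · simp only [Matrix.transpose_apply, Matrix.of_apply, Fin.cons_succ, pext, Fin.is_lt, dif_pos,
      extv, coordE, Fin.val_succ]
    by_cases h : (r : ℕ) + 1 = j + 2 - 1
    · have : (r : ℕ) = j := by omega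
      simp [this]
    · simp [h]
      intro h2; omega

lemma OT_iff {d n : ℕ} (p : Fin n → (Fin d → ℝ)) : SuperOTHomog p ↔ OTc d n (pext p) := by
  constructor
  · intro h j hj
    have conv : ∀ t : Fin (j+2) → ℕ, StrictMono t → t (Fin.last _) < n →
        ∃ s : Fin (j+2) → Fin n, StrictMono s ∧ ∀ i, (s i : ℕ) = t i := fun t ht hn =>
      ⟨fun i => ⟨t i, lt_of_le_of_lt (ht.monotone (Fin.le_last _)) hn⟩, fun x y h => ht h,
        fun i => rfl⟩
    rcases h (j+1) (by omega) (by omega) with h | h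
    · refine ⟨1, Or.inl rfl, fun t ht hn => ?_⟩
      obtain ⟨s, hs, hst⟩ := conv t ht hn
      have := h s hs
      rw [Dj_EE] at this
      simpa [hst] using this
    · refine ⟨-1, Or.inr rfl, fun t ht hn => ?_⟩
      obtain ⟨s, hs, hst⟩ := conv t ht hn
      have := h s hs
      rw [Dj_EE] at this
      simpa [hst] using this
  · intro h j h1 hj
    obtain ⟨j, rfl⟩ : ∃ k, j = k + 1 := ⟨j - 1, by omega⟩
    obtain ⟨e, he, h⟩ := h j (by omega)
    rcases he with rfl | rfl
    · left
      intro t ht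
      rw [Dj_EE]
      simpa using h (fun i => t i) (fun x y h => ht h) (t _).2
    · right
      intro t ht
      rw [Dj_EE]
      simpa using h (fun i => t i) (fun x y h => ht h) (t _).2

lemma step_lt (f : ℕ → ℝ) (j n : ℕ) (h : ∀ a, a + j + 1 < n → f a < f (a+1)) (a b : ℕ)
    (hb : b + (j + 1) ≤ n) (hab : a < b) : f a < f b := by
  induction b with
  | zero => omega
  | succ b ih =>
    have h1 := h b (by omega)
    rcases Nat.lt_succ_iff_lt_or_eq.1 hab with h2 | rfl
    · exact (ih (by omega) h2).trans h1
    · exact h1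

lemma win_eq {d n : ℕ} (p : Fin n → (Fin d → ℝ)) (j a : ℕ) :
    win p (j+1) a = sdel j (fun i => pext p (a + (i : ℕ))) := rfl

lemma SM_iff {d n : ℕ} (p : Fin n → (Fin d → ℝ)) : SuperMonotone p ↔ SMc d n (pext p) := by
  constructor
  · intro h j hj
    rcases h (j+1) (by omega) (by omega) with h | h
    · refine ⟨1, Or.inl rfl, fun a ha => ?_⟩
      have := h a (a+1) (by omega) (by omega) (by omega)
      simp only [win_eq] at this
      linarith
    · refine ⟨-1, Or.inr rfl, fun a ha => ?_⟩
      have := h a (a+1) (by omega) (by omega) (by omega)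
      simp only [win_eq] at this
      linarith
  · intro h j h1 hj
    obtain ⟨j, rfl⟩ : ∃ k, j = k + 1 := ⟨j - 1, by omega⟩
    obtain ⟨e, he, h⟩ := h j (by omega)
    rcases he with rfl | rfl
    · left
      intro a b _ hb hab
      refine step_lt (fun a => win p (j+1) a 0) j n (fun a ha => ?_) a b hb hab
      have := h a ha
      simp only [win_eq]
      linarith
    · right
      intro a b _ hb hab
      have := step_lt (fun a => - win p (j+1) a 0) j n (fun a ha => ?_) a b hb hab
      · simpa using this
      have := h a ha
      simp only [win_eq]
      linarith

/-- a point sequence in strong general position in `ℝ^d` is super-monotone if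
and only if it is super-order-type homogeneous. -/
theorem supermonotone_iff_superOTH (d n : ℕ) (p : Fin n → (Fin d → ℝ))
    (hgen : StrongGenPos p) :
    SuperMonotone p ↔ SuperOTHomog p := by
  rw [SM_iff, OT_iff]
  exact ⟨SM_OT d n _, fun h => CO_SM d n _ (OT_CO d n _ h)⟩

end
end
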